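/- arXiv:1310.4393 — 7 statements merged into one kernel-verified Lean document; each statement's English description precedes it below -/
import Mathlib

section
/- Strong duality holds between the primal and dual problems: min_{π ∈ Δ_m} F_α(π) = max_{q ∈ B_∞} (−J_α(q)) = −min_{q ∈ B_∞} J_α(q), and both extrema are attained. -/
lemma aux_gibbs {m : ℕ} (a w : Fin m → ℝ) (hw : w ∈ stdSimplex ℝ (Fin m)) :
    ∑ j, w j * a j - ∑ j, w j * Real.log (w j) ≤ Real.log (∑ k, Real.exp (a k)) := by
  obtain ⟨h0, h1⟩ := hw
  have hm : (Finset.univ : Finset (Fin m)).Nonempty := by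
    by_contra h
    rw [Finset.not_nonempty_iff_eq_empty] at h
    rw [h] at h1
    simp at h1
  have hZ : 0 < ∑ k, Real.exp (a k) := Finset.sum_pos (fun _ _ => Real.exp_pos _) hm
  set Z := ∑ k, Real.exp (a k) with hZdef
  have key : ∀ j, w j * (a j) - w j * Real.log (w j) - w j * Real.log Z
      ≤ Real.exp (a j) / Z - w j := by
    intro j
    rcases (h0 j).eq_or_lt with h | h
    · rw [← h]
      simp only [zero_mul, sub_zero]
      positivity
    · have hx : 0 < Real.exp (a j) / Z / w j := by positivity
      have h2 := Real.log_le_sub_one_of_pos hx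
      rw [Real.log_div (by positivity) h.ne', Real.log_div (by positivity) hZ.ne',
        Real.log_exp] at h2
      have h3 := mul_le_mul_of_nonneg_left h2 h.le
      have h4 : w j * (Real.exp (a j) / Z / w j - 1) = Real.exp (a j) / Z - w j := by
        field_simp
      rw [h4] at h3
      linarith
  have hs := Finset.sum_le_sum (s := Finset.univ) (fun j _ => key j)
  simp only [Finset.sum_sub_distrib] at hs
  rw [← Finset.sum_mul, ← Finset.sum_div, h1, ← hZdef, div_self hZ.ne'] at hs
  linarith

lemma aux_deriv {f : ℝ → ℝ} {d : ℝ} (h : HasDerivAt f d 0)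
    (hmin : ∀ t ∈ Set.Icc (0:ℝ) 1, f 0 ≤ f t) : 0 ≤ d := by
  have h1 := h.hasDerivWithinAt (s := Set.Ioi 0)
  rw [hasDerivWithinAt_iff_tendsto_slope' (by simp)] at h1
  refine ge_of_tendsto h1 ?_
  have : Set.Ioo (0:ℝ) 1 ∈ nhdsWithin 0 (Set.Ioi 0) := Ioo_mem_nhdsGT one_pos
  filter_upwards [this] with t ht
  rw [slope_def_field]
  exact div_nonneg (sub_nonneg.2 (hmin t ⟨ht.1.le, ht.2.le⟩)) (by linarith [ht.1])

lemma aux_swap {n m : ℕ} (M : Matrix (Fin n) (Fin m) ℝ) (w : Fin m → ℝ) (q : Fin n → ℝ) :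
    ∑ i, M.mulVec w i * q i = ∑ j, w j * M.transpose.mulVec q j := by
  simp only [Matrix.mulVec, dotProduct, Matrix.transpose_apply, Finset.sum_mul, Finset.mul_sum]
  rw [Finset.sum_comm]
  exact Finset.sum_congr rfl fun _ _ => Finset.sum_congr rfl fun _ _ => by ring

/-- strong duality between the primal problem `min_{π ∈ Δ_m} F_α(π)`, where
`F_α(π) = ‖Mπ − p‖_{ℓ¹} + α ∑ π_j log π_j`, and the dual problem `min_{q ∈ B_∞} J_α(q)`,
where `J_α(q) = ⟨p, q⟩ + α log(∑ exp(−(Mᵀq)_k/α))` and `B_∞` is the unit `ℓ^∞` ball: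
both extrema are attained and `min F_α = −min J_α`. -/
theorem stmt4 (n m : ℕ) (hn : 0 < n) (hm : 0 < m)
    (M : Matrix (Fin n) (Fin m) ℝ) (p : Fin n → ℝ) (α : ℝ) (hα : 0 < α) :
    let F : (Fin m → ℝ) → ℝ := fun π =>
      (∑ i, |M.mulVec π i - p i|) + α * ∑ j, π j * Real.log (π j)
    let J : (Fin n → ℝ) → ℝ := fun q =>
      (∑ i, p i * q i) + α * Real.log (∑ k, Real.exp (-(M.transpose.mulVec q k) / α))
    let B : Set (Fin n → ℝ) := {q | ∀ i, |q i| ≤ 1}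
    ∃ πs ∈ stdSimplex ℝ (Fin m), ∃ qs ∈ B,
      (∀ π ∈ stdSimplex ℝ (Fin m), F πs ≤ F π) ∧
      (∀ q ∈ B, J qs ≤ J q) ∧
      F πs = -J qs := by
  intro F J B
  have hne : (Finset.univ : Finset (Fin m)).Nonempty := ⟨⟨0, hm⟩, Finset.mem_univ _⟩
  have weak : ∀ w ∈ stdSimplex ℝ (Fin m), ∀ q ∈ B, -J q ≤ F w := by
    intro w hw q hq
    have hg := aux_gibbs (fun k => -(M.transpose.mulVec q k) / α) w hw
    have h1 : ∑ i, (M.mulVec w i - p i) * q i ≤ ∑ i, |M.mulVec w i - p i| := by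
      refine Finset.sum_le_sum fun i _ => ?_
      calc (M.mulVec w i - p i) * q i ≤ |(M.mulVec w i - p i) * q i| := le_abs_self _
        _ = |M.mulVec w i - p i| * |q i| := abs_mul _ _
        _ ≤ |M.mulVec w i - p i| * 1 := mul_le_mul_of_nonneg_left (hq i) (abs_nonneg _)
        _ = _ := mul_one _
    simp only [sub_mul, Finset.sum_sub_distrib] at h1
    rw [aux_swap] at h1
    have h2 : α * ∑ j, w j * (-(M.transpose.mulVec q j) / α)
        = - ∑ j, w j * M.transpose.mulVec q j := by
      rw [Finset.mul_sum, ← Finset.sum_neg_distrib]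
      exact Finset.sum_congr rfl fun j _ => by field_simp
    have h3 := mul_le_mul_of_nonneg_left hg hα.le
    rw [mul_sub, h2] at h3
    simp only [F, J]
    linarith
  have hB : IsCompact B := by
    have : B = Set.pi Set.univ (fun _ => Set.Icc (-1:ℝ) 1) := by
      ext q
      simp only [B, abs_le, Set.mem_pi, Set.mem_setOf_eq, Set.mem_univ, true_imp_iff, Set.mem_Icc]
    rw [this]
    exact isCompact_univ_pi fun _ => isCompact_Icc
  have hpos : ∀ q : Fin n → ℝ, 0 < ∑ k, Real.exp (-(M.transpose.mulVec q k) / α) :=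
    fun q => Finset.sum_pos (fun _ _ => Real.exp_pos _) hne
  have hJ : Continuous J := by
    refine Continuous.add (by fun_prop) (continuous_const.mul (Continuous.log ?_ fun q => (hpos q).ne'))
    refine continuous_finsetSum _ fun k _ => Real.continuous_exp.comp ?_
    have : Continuous fun q => M.transpose.mulVec q k := by
      simp only [Matrix.mulVec, dotProduct]
      fun_prop
    exact this.neg.div_const _
  obtain ⟨qs, hqs, hmin⟩ := hB.exists_isMinOn ⟨0, by simp [B]⟩ hJ.continuousOn
  have hmin' : ∀ q ∈ B, J qs ≤ J q := fun q hq => hmin hq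
  set a : Fin m → ℝ := fun k => -(M.transpose.mulVec qs k) / α with ha
  set Z := ∑ k, Real.exp (a k) with hZdef
  have hZ : 0 < Z := hpos qs
  set w : Fin m → ℝ := fun j => Real.exp (a j) / Z with hwdef
  have hw1 : ∑ j, w j = 1 := by
    simp only [hwdef]
    rw [← Finset.sum_div, ← hZdef, div_self hZ.ne']
  have hw : w ∈ stdSimplex ℝ (Fin m) := ⟨fun j => by simp only [hwdef]; positivity, hw1⟩
  have hE : α * ∑ j, w j * Real.log (w j)
      = - ∑ j, w j * M.transpose.mulVec qs j - α * Real.log Z := by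
    have : ∀ j, w j * Real.log (w j) = w j * a j - w j * Real.log Z := by
      intro j
      have : Real.log (w j) = a j - Real.log Z := by
        simp only [hwdef]
        rw [Real.log_div (by positivity) hZ.ne', Real.log_exp]
      rw [this]
      ring
    simp only [this]
    rw [Finset.sum_sub_distrib, ← Finset.sum_mul, hw1, mul_sub, one_mul, Finset.mul_sum,
      ← Finset.sum_neg_distrib]
    congr 1
    refine Finset.sum_congr rfl fun j _ => ?_
    simp only [ha]
    field_simp
  -- first order condition
  have foc : ∀ q ∈ B, 0 ≤ ∑ i, p i * (q i - qs i)
      - ∑ j, w j * M.transpose.mulVec (fun i => q i - qs i) j := by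
    intro q hq
    set v : Fin n → ℝ := fun i => q i - qs i with hv
    have hin : ∀ k, HasDerivAt (fun t : ℝ => Real.exp (-(M.transpose.mulVec (qs + t • v) k) / α))
        (Real.exp (a k) * (-(M.transpose.mulVec v k) / α)) 0 := by
      intro k
      have h1 : HasDerivAt (fun t : ℝ => -(M.transpose.mulVec (qs + t • v) k) / α)
          (-(M.transpose.mulVec v k) / α) 0 := by
        have h2 : (fun t : ℝ => -(M.transpose.mulVec (qs + t • v) k) / α)
            = fun t : ℝ => a k + t * (-(M.transpose.mulVec v k) / α) := by
          funext t
          simp only [ha, Matrix.mulVec_add, Matrix.mulVec_smul, Pi.add_apply, Pi.smul_apply,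
            smul_eq_mul]
          ring
        rw [h2]
        simpa using ((hasDerivAt_id (0:ℝ)).mul_const (-(M.transpose.mulVec v k) / α)).const_add (a k)
      have h3 := h1.exp
      simpa [ha] using h3
    have hS := HasDerivAt.fun_sum (u := Finset.univ) (fun k _ => hin k)
    have hL := (hS.log (hpos _).ne').const_mul α
    have hlin : HasDerivAt (fun t : ℝ => ∑ i, p i * (qs + t • v) i) (∑ i, p i * v i) 0 := by
      refine HasDerivAt.fun_sum fun i _ => ?_
      simpa using (((hasDerivAt_id (0:ℝ)).mul_const (v i)).const_add (qs i)).const_mul (p i)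
    have hd := aux_deriv (hlin.add hL) (by
      intro t ht
      have := hmin' (qs + t • v) (by
        intro i
        have h1 := abs_le.1 (hq i)
        have h2 := abs_le.1 (hqs i)
        simp only [Pi.add_apply, Pi.smul_apply, smul_eq_mul, hv]
        rw [abs_le]
        constructor <;> nlinarith [ht.1, ht.2])
      simpa [J] using this)
    convert hd using 1
    rw [sub_eq_add_neg]
    congr 1
    simp only [zero_smul, add_zero]
    change _ = α * ((∑ k, Real.exp (a k) * (-(M.transpose.mulVec v k) / α)) / Z)
    rw [Finset.sum_div, Finset.mul_sum, ← Finset.sum_neg_distrib]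
    refine Finset.sum_congr rfl fun j _ => ?_
    simp only [hwdef]
    field_simp
  have hF : F w ≤ -J qs := by
    have h := foc (fun i => SignType.sign (M.mulVec w i - p i)) (by
      intro i
      rcases lt_trichotomy (M.mulVec w i - p i) 0 with h | h | h
      · simp [sign_neg h]
      · simp [h]
      · simp [sign_pos h])
    rw [← aux_swap, ← Finset.sum_sub_distrib] at h
    have h2 : ∑ i, (p i * ((SignType.sign (M.mulVec w i - p i) : ℝ) - qs i)
        - M.mulVec w i * ((SignType.sign (M.mulVec w i - p i) : ℝ) - qs i))
        = ∑ i, M.mulVec w i * qs i - ∑ i, p i * qs i - ∑ i, |M.mulVec w i - p i| := by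
      rw [← Finset.sum_sub_distrib, ← Finset.sum_sub_distrib]
      refine Finset.sum_congr rfl fun i _ => ?_
      rw [← self_mul_sign]
      ring
    rw [h2, aux_swap] at h
    have h3 : J qs = ∑ i, p i * qs i + α * Real.log Z := rfl
    have h4 : F w = (∑ i, |M.mulVec w i - p i|) + α * ∑ j, w j * Real.log (w j) := rfl
    rw [h3, h4, hE]
    linarith
  exact ⟨w, hw, qs, hqs, fun π hπ => hF.trans (weak π hπ qs hqs), hmin',
    le_antisymm hF (weak w hw qs hqs)⟩
end

section
/- For every m ≥ 1 and every p ∈ [1, ∞], the neg-entropy E(π) = Σ_{j=1}^m π_j log π_j is 1-strongly convex on the simplex Δ_m with respect to the ℓ^p norm; in particular, for all x, y ∈ Δ_m and all t ∈ [0, 1]: E(tx + (1−t)y) ≤ t E(x) + (1−t) E(y) − (1/2) t(1−t) ‖x − y‖_{ℓ¹}², and the same inequality holds with ‖·‖_{ℓ¹} replaced by any ℓ^p norm. -/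
open scoped ENNReal

/-- The `ℓ^p` norm on `Fin n → ℝ`, for `p ∈ [1, ∞]` (an extended nonnegative real);
`pnorm ⊤ x = sup_i |x i|` and `pnorm p x = (∑ i, |x i|^p)^(1/p)` for finite `p`. -/
noncomputable def pnorm {n : ℕ} (p : ℝ≥0∞) (x : Fin n → ℝ) : ℝ :=
  if p = ⊤ then ⨆ i, |x i| else (∑ i, |x i| ^ p.toReal) ^ (1 / p.toReal)

lemma aux_log (u : ℝ) (hu : 0 < u) :
    (5 * u ^ 2 - 4 * u - 1) / (2 * u ^ 2 + 4 * u) ≤ Real.log u := by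
  have hd : ∀ v : ℝ, 0 < v → HasDerivAt
      (fun u : ℝ => Real.log u - (5 * u ^ 2 - 4 * u - 1) / (2 * u ^ 2 + 4 * u))
      ((v - 1) ^ 3 / (v ^ 2 * (v + 2) ^ 2)) v := by
    intro v hv
    have h1 : HasDerivAt (fun u : ℝ => 5 * u ^ 2 - 4 * u - 1) (10 * v - 4) v := by
      have := (((hasDerivAt_id v).pow 2).const_mul 5).sub ((hasDerivAt_id v).const_mul 4)
      have := this.sub_const 1
      refine this.congr_deriv ?_
      simp only [id]; norm_num; try ring
    have h2 : HasDerivAt (fun u : ℝ => 2 * u ^ 2 + 4 * u) (4 * v + 4) v := by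
      have := (((hasDerivAt_id v).pow 2).const_mul 2).add ((hasDerivAt_id v).const_mul 4)
      refine this.congr_deriv ?_
      simp only [id]; norm_num; try ring
    have hne : 2 * v ^ 2 + 4 * v ≠ 0 := by positivity
    have h3 := (Real.hasDerivAt_log hv.ne').sub (h1.div h2 hne)
    refine h3.congr_deriv ?_
    have : v + 2 ≠ 0 := by positivity
    have e : 2 * v ^ 2 + 4 * v = 2 * v * (v + 2) := by ring
    rw [e]
    field_simp
    ring
  set f := (fun u : ℝ => Real.log u - (5 * u ^ 2 - 4 * u - 1) / (2 * u ^ 2 + 4 * u)) with hf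
  have f1 : f 1 = 0 := by simp [hf]; norm_num
  have key : 0 ≤ f u := by
    rw [← f1]
    rcases le_total u 1 with h | h
    · have : AntitoneOn f (Set.Icc u 1) := by
        refine antitoneOn_of_hasDerivWithinAt_nonpos (f' := fun v => (v - 1) ^ 3 / (v ^ 2 * (v + 2) ^ 2))
          (convex_Icc _ _) ?_ ?_ ?_
        · intro v hv
          exact (hd v (hu.trans_le hv.1)).continuousAt.continuousWithinAt
        · intro v hv
          rw [interior_Icc] at hv
          exact (hd v (hu.trans hv.1)).hasDerivWithinAt
        · intro v hv
          rw [interior_Icc] at hv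
          refine div_nonpos_of_nonpos_of_nonneg ?_ (by positivity)
          have h1 : v - 1 ≤ 0 := by linarith [hv.2]
          exact Odd.pow_nonpos (by decide) h1
      exact this ⟨le_rfl, h⟩ ⟨h, le_rfl⟩ h
    · have : MonotoneOn f (Set.Icc 1 u) := by
        refine monotoneOn_of_hasDerivWithinAt_nonneg (f' := fun v => (v - 1) ^ 3 / (v ^ 2 * (v + 2) ^ 2))
          (convex_Icc _ _) ?_ ?_ ?_
        · intro v hv
          exact (hd v (one_pos.trans_le hv.1)).continuousAt.continuousWithinAt
        · intro v hv
          rw [interior_Icc] at hv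
          exact (hd v (one_pos.trans hv.1)).hasDerivWithinAt
        · intro v hv
          rw [interior_Icc] at hv
          have h1 : 0 ≤ v - 1 := by linarith [hv.1]
          positivity
      exact this ⟨le_rfl, h⟩ ⟨h, le_rfl⟩ h
  simp only [hf] at key
  linarith

lemma aux_pt (x z : ℝ) (hx : 0 ≤ x) (hz : 0 ≤ z) (h : z = 0 → x = 0) :
    3 / 2 * ((x - z) ^ 2 / (x + 2 * z)) ≤ x * Real.log x - x * Real.log z - x + z := by
  rcases hz.eq_or_lt with hz | hz
  · have := h hz.symm
    subst this; subst hz; simp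
  rcases hx.eq_or_lt with hx | hx
  · subst hx
    simp
    have : z ^ 2 / (2 * z) = z / 2 := by field_simp
    rw [this]; linarith
  have := aux_log (x / z) (by positivity)
  rw [Real.log_div hx.ne' hz.ne'] at this
  have h2 := mul_le_mul_of_nonneg_left this hx.le
  have h3 : x * ((5 * (x / z) ^ 2 - 4 * (x / z) - 1) / (2 * (x / z) ^ 2 + 4 * (x / z)))
      = 3 / 2 * ((x - z) ^ 2 / (x + 2 * z)) + x - z := by
    have e : 2 * (x / z) ^ 2 + 4 * (x / z) = 2 * x * (x + 2 * z) / z ^ 2 := by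
      field_simp
      ring
    have : x + 2 * z ≠ 0 := by positivity
    rw [e]
    field_simp
    ring
  rw [h3] at h2
  linarith

lemma aux_pinsker {m : ℕ} (x z : Fin m → ℝ) (hx : x ∈ stdSimplex ℝ (Fin m))
    (hz : z ∈ stdSimplex ℝ (Fin m)) (h : ∀ j, z j = 0 → x j = 0) :
    1 / 2 * (∑ j, |x j - z j|) ^ 2 ≤
      ∑ j, x j * Real.log (x j) - ∑ j, x j * Real.log (z j) := by
  have h1 := Finset.sum_le_sum (s := Finset.univ)
    (fun j _ => aux_pt (x j) (z j) (hx.1 j) (hz.1 j) (h j))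
  rw [← Finset.mul_sum] at h1
  simp only [Finset.sum_add_distrib, Finset.sum_sub_distrib, hx.2, hz.2] at h1
  have h2 := Finset.sum_sq_le_sum_mul_sum_of_sq_eq_mul Finset.univ
    (r := fun j => |x j - z j|) (f := fun j => (x j - z j) ^ 2 / (x j + 2 * z j))
    (g := fun j => x j + 2 * z j)
    (fun j _ => by have := hx.1 j; have := hz.1 j; positivity)
    (fun j _ => by have := hx.1 j; have := hz.1 j; positivity)
    (fun j _ => by
      have a := hx.1 j
      have b := hz.1 j
      rw [sq_abs]
      rcases b.eq_or_lt with b | b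
      · simp [← b, h j b.symm]
      · have : x j + 2 * z j ≠ 0 := by positivity
        field_simp)
  rw [Finset.sum_add_distrib, ← Finset.mul_sum, hx.2, hz.2] at h2
  linarith

lemma aux_pnorm {m : ℕ} (hm : 0 < m) (p : ℝ≥0∞) (hp : 1 ≤ p) (v : Fin m → ℝ) :
    0 ≤ pnorm p v ∧ pnorm p v ≤ ∑ j, |v j| := by
  have hs : ∀ j, |v j| ≤ ∑ j, |v j| := fun j =>
    Finset.single_le_sum (f := fun j => |v j|) (fun i _ => abs_nonneg _) (Finset.mem_univ j)
  have hS : 0 ≤ ∑ j, |v j| := Finset.sum_nonneg (fun i _ => abs_nonneg _)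
  unfold pnorm
  split_ifs with hpt
  · haveI : Nonempty (Fin m) := ⟨⟨0, hm⟩⟩
    exact ⟨Real.iSup_nonneg (fun i => abs_nonneg _), ciSup_le hs⟩
  · have hq : 1 ≤ p.toReal := by
      have := ENNReal.toReal_mono hpt hp
      simpa using this
    set q := p.toReal
    have hle : ∑ i, |v i| ^ q ≤ (∑ j, |v j|) ^ q := by
      have e : ∀ a : ℝ, 0 ≤ a → a ^ q = a * a ^ (q - 1) := by
        intro a ha
        have := Real.rpow_add_of_nonneg ha zero_le_one (sub_nonneg.2 hq)
        rw [Real.rpow_one] at this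
        rw [← this]; congr 1; ring
      rw [e _ hS, Finset.sum_mul]
      refine Finset.sum_le_sum (fun i _ => ?_)
      rw [e _ (abs_nonneg _)]
      exact mul_le_mul_of_nonneg_left
        (Real.rpow_le_rpow (abs_nonneg _) (hs i) (sub_nonneg.2 hq)) (abs_nonneg _)
    have h0 : 0 ≤ ∑ i, |v i| ^ q :=
      Finset.sum_nonneg (fun i _ => Real.rpow_nonneg (abs_nonneg _) _)
    refine ⟨Real.rpow_nonneg h0 _, ?_⟩
    have := Real.rpow_le_rpow h0 hle (z := 1 / q) (by positivity)
    rwa [← Real.rpow_mul hS, mul_one_div_cancel (by positivity), Real.rpow_one] at this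

/-- the neg-entropy `E(π) = ∑ π_j log π_j` is `1`-strongly convex on the
simplex `Δ_m` with respect to every `ℓ^p` norm, `p ∈ [1, ∞]` (in particular w.r.t. `ℓ¹`,
which is the case `p = 1`). -/
theorem stmt6 (m : ℕ) (hm : 0 < m) (p : ℝ≥0∞) (hp : 1 ≤ p) :
    ∀ x ∈ stdSimplex ℝ (Fin m), ∀ y ∈ stdSimplex ℝ (Fin m), ∀ t ∈ Set.Icc (0 : ℝ) 1,
      (∑ j, (t • x + (1 - t) • y) j * Real.log ((t • x + (1 - t) • y) j)) ≤
        t * (∑ j, x j * Real.log (x j)) + (1 - t) * (∑ j, y j * Real.log (y j)) -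
          1 / 2 * t * (1 - t) * pnorm p (x - y) ^ 2 := by
  intro x hx y hy t ht
  rcases ht.1.eq_or_lt with h0 | h0
  · subst h0; simp
  rcases ht.2.eq_or_lt with h1 | h1
  · subst h1; simp
  have h1' : 0 < 1 - t := by linarith
  have hz : t • x + (1 - t) • y ∈ stdSimplex ℝ (Fin m) :=
    (convex_stdSimplex ℝ (Fin m)) hx hy h0.le h1'.le (by ring)
  set z := t • x + (1 - t) • y with hzdef
  have ez : ∀ j, z j = t * x j + (1 - t) * y j := fun j => by simp [hzdef]
  have hzx : ∀ j, z j = 0 → x j = 0 := by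
    intro j hj
    rw [ez] at hj
    have a := mul_nonneg h0.le (hx.1 j)
    have b := mul_nonneg h1'.le (hy.1 j)
    have : t * x j = 0 := by linarith
    exact (mul_eq_zero.1 this).resolve_left h0.ne'
  have hzy : ∀ j, z j = 0 → y j = 0 := by
    intro j hj
    rw [ez] at hj
    have a := mul_nonneg h0.le (hx.1 j)
    have b := mul_nonneg h1'.le (hy.1 j)
    have : (1 - t) * y j = 0 := by linarith
    exact (mul_eq_zero.1 this).resolve_left h1'.ne'
  have p1 := aux_pinsker x z hx hz hzx
  have p2 := aux_pinsker y z hy hz hzy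
  have s1 : ∑ j, |x j - z j| = (1 - t) * ∑ j, |(x - y) j| := by
    rw [Finset.mul_sum]
    refine Finset.sum_congr rfl (fun j _ => ?_)
    rw [← abs_of_pos h1', ← abs_mul, ez, Pi.sub_apply]
    congr 1; ring
  have s2 : ∑ j, |y j - z j| = t * ∑ j, |(x - y) j| := by
    rw [Finset.mul_sum]
    refine Finset.sum_congr rfl (fun j _ => ?_)
    rw [abs_sub_comm, ← abs_of_pos h0, ← abs_mul, ez, Pi.sub_apply]
    congr 1; ring
  have s3 : ∑ j, z j * Real.log (z j) =
      t * ∑ j, x j * Real.log (z j) + (1 - t) * ∑ j, y j * Real.log (z j) := by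
    rw [Finset.mul_sum, Finset.mul_sum, ← Finset.sum_add_distrib]
    refine Finset.sum_congr rfl (fun j _ => ?_)
    nth_rw 1 [ez]; ring
  obtain ⟨n0, n1⟩ := aux_pnorm hm p hp (x - y)
  have n2 := pow_le_pow_left₀ n0 n1 2
  rw [s1] at p1
  rw [s2] at p2
  rw [s3]
  have q1 := mul_le_mul_of_nonneg_left p1 h0.le
  have q2 := mul_le_mul_of_nonneg_left p2 h1'.le
  have q3 := mul_le_mul_of_nonneg_left n2 (mul_pos h0 h1').le
  linarith
end

section
/- For m ≥ 2, the constant 1 in the strong convexity of the neg-entropy with respect to the ℓ¹ norm on the simplex is optimal: for every σ > 1 there exist x, y ∈ Δ_m and t ∈ (0, 1) such that E(tx + (1−t)y) > t E(x) + (1−t) E(y) − (σ/2) t(1−t) ‖x − y‖_{ℓ¹}². Hence the convexity modulus of E on Δ_m with respect to ‖·‖_{ℓ¹} equals exactly 1. -/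
theorem aux_h (e σ : ℝ) (h0 : 0 < e) (h1 : e < 1) (hs : e < (σ - 1) * (1 - e)) :
    (1 + e) / 2 * Real.log ((1 + e) / 2) + (1 - e) / 2 * Real.log ((1 - e) / 2)
      - σ / 2 * e ^ 2 < Real.log (1 / 2) := by
  have hp : 0 < 1 + e := by linarith
  have hq : 0 < 1 - e := by linarith
  rw [Real.log_div hp.ne' two_ne_zero, Real.log_div hq.ne' two_ne_zero,
    Real.log_div one_ne_zero two_ne_zero, Real.log_one]
  have a1 : Real.log (1 + e) ≤ e := by
    have := Real.log_le_sub_one_of_pos hp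
    linarith
  have a2 : 1 - (1 - e)⁻¹ ≤ Real.log (1 - e) := Real.one_sub_inv_le_log_of_pos hq
  have a3 : Real.log (1 + e) + Real.log (1 - e) ≤ - e ^ 2 := by
    rw [← Real.log_mul hp.ne' hq.ne']
    have := Real.log_le_sub_one_of_pos (mul_pos hp hq)
    nlinarith
  have a4 : (1 - e)⁻¹ < 1 + e + (σ - 1) * e := by
    rw [inv_lt_iff_one_lt_mul₀ hq]
    nlinarith
  have a5 : e * (Real.log (1 + e) - Real.log (1 - e)) < e * (2 * e + (σ - 1) * e) :=
    mul_lt_mul_of_pos_left (by linarith) h0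
  nlinarith

/-- for `m ≥ 2` the constant `1` in the strong convexity of the neg-entropy
w.r.t. the `ℓ¹` norm on the simplex is optimal: for every `σ > 1` the `σ`-strong-convexity
inequality fails at some `x, y ∈ Δ_m` and `t ∈ (0, 1)`. Hence the convexity modulus of the
neg-entropy on `Δ_m` w.r.t. `‖·‖_{ℓ¹}` equals exactly `1`. -/
theorem stmt7 (m : ℕ) (hm : 2 ≤ m) :
    let E : (Fin m → ℝ) → ℝ := fun π => ∑ j, π j * Real.log (π j)
    ∀ σ : ℝ, 1 < σ →
      ∃ x ∈ stdSimplex ℝ (Fin m), ∃ y ∈ stdSimplex ℝ (Fin m), ∃ t ∈ Set.Ioo (0 : ℝ) 1,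
        t * E x + (1 - t) * E y - σ / 2 * t * (1 - t) * (∑ j, |x j - y j|) ^ 2 <
          E (t • x + (1 - t) • y) := by
  intro E σ hσ
  obtain ⟨n, rfl⟩ : ∃ n, m = n + 2 := ⟨m - 2, by omega⟩
  obtain ⟨e, h0, h1, hs⟩ : ∃ e : ℝ, 0 < e ∧ e < 1 ∧ e < (σ - 1) * (1 - e) := by
    have hσ0 : 0 < σ := by linarith
    refine ⟨(σ - 1) / (2 * σ), by apply div_pos <;> linarith, ?_, ?_⟩
    · rw [div_lt_one (by linarith)]; linarith
    · have h : 1 - (σ - 1) / (2 * σ) = (σ + 1) / (2 * σ) := by field_simp; ring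
      rw [h, ← mul_div_assoc]
      apply div_lt_div_of_pos_right _ (by linarith)
      nlinarith
  let v : ℝ → ℝ → Fin (n + 2) → ℝ := fun a b => Fin.cons a (Fin.cons b (fun _ => 0))
  have hE : ∀ a b, E (v a b) = a * Real.log a + b * Real.log b := by
    intro a b
    simp [E, v, Fin.sum_univ_succ]
  have hv : ∀ a b, 0 ≤ a → 0 ≤ b → a + b = 1 → v a b ∈ stdSimplex ℝ (Fin (n + 2)) := by
    intro a b ha hb hab
    refine ⟨fun j => ?_, ?_⟩
    · refine Fin.cases ?_ (fun j => ?_) j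
      · simpa [v] using ha
      · refine Fin.cases ?_ (fun j => ?_) j
        · simpa [v] using hb
        · simp [v]
    · simp [v, Fin.sum_univ_succ, hab]
  have hn : ∑ j, |v ((1 + e) / 2) ((1 - e) / 2) j - v ((1 - e) / 2) ((1 + e) / 2) j| = 2 * e := by
    have b1 : (1 + e) / 2 - (1 - e) / 2 = e := by ring
    have b2 : (1 - e) / 2 - (1 + e) / 2 = -e := by ring
    simp [v, Fin.sum_univ_succ, b1, b2, abs_of_pos h0]
    ring
  have hmid : (1 / 2 : ℝ) • v ((1 + e) / 2) ((1 - e) / 2)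
      + (1 - 1 / 2 : ℝ) • v ((1 - e) / 2) ((1 + e) / 2) = v (1 / 2) (1 / 2) := by
    funext j
    refine Fin.cases ?_ (fun j => ?_) j
    · simp [v]; ring
    · refine Fin.cases ?_ (fun j => ?_) j
      · simp [v]; ring
      · simp [v]
  refine ⟨v ((1 + e) / 2) ((1 - e) / 2), hv _ _ (by linarith) (by linarith) (by ring),
    v ((1 - e) / 2) ((1 + e) / 2), hv _ _ (by linarith) (by linarith) (by ring),
    1 / 2, ⟨by norm_num, by norm_num⟩, ?_⟩
  rw [hmid, hn, hE, hE, hE]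
  have := aux_h e σ h0 h1 hs
  linarith
end

section
/- Fix α > 0 and define the softmax map s_α : R^m → Δ_m by s_α(c)_j = exp(−c_j/α) / Σ_{k=1}^m exp(−c_k/α). Then s_α is (1/α)-Lipschitz from the ℓ^∞ norm to the ℓ¹ norm: for all c₁, c₂ ∈ R^m, ‖s_α(c₁) − s_α(c₂)‖_{ℓ¹} ≤ (1/α) ‖c₁ − c₂‖_{ℓ^∞}. -/
lemma aux_two (a b a' b' d : ℝ) (hd : 0 ≤ d) (ha : 0 ≤ a) (hb : 0 ≤ b) (ha' : 0 ≤ a')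
    (hb' : 0 ≤ b') (hab : 0 < a + b) (hab' : 0 < a' + b')
    (h1 : a ≤ Real.exp d * a') (h2 : b' ≤ Real.exp d * b) :
    a / (a + b) - a' / (a' + b') ≤ d / 2 := by
  have hl := Real.le_log_one_add_of_nonneg (x := Real.exp d - 1)
    (by linarith [Real.add_one_le_exp d])
  have hx1 : 1 ≤ Real.exp d := by linarith [Real.add_one_le_exp d]
  rw [show 1 + (Real.exp d - 1) = Real.exp d by ring, Real.log_exp] at hl
  set x := Real.exp d
  have hx : (x - 1) / (x + 1) ≤ d / 2 := by
    rw [show x - 1 + 2 = x + 1 by ring, mul_div_assoc] at hl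
    linarith
  refine le_trans ?_ hx
  have key : a * b' ≤ x ^ 2 * (a' * b) := by
    calc a * b' ≤ (x * a') * (x * b) := mul_le_mul h1 h2 hb' (by positivity)
      _ = _ := by ring
  rw [div_sub_div _ _ hab.ne' hab'.ne', div_le_div_iff₀ (by positivity) (by positivity)]
  -- with u = a b', v = a' b: (u - v)(x+1) ≤ (x-1)(aa' + u + v + bb')
  have e : 2 * (a * b' - x * (a' * b)) ≤ (x - 1) * (a * a' + b * b') := by
    by_cases hs : a * b' - x * (a' * b) ≤ 0
    · have : 0 ≤ (x - 1) * (a * a' + b * b') :=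
        mul_nonneg (by linarith) (by positivity)
      linarith
    · push Not at hs
      have hA : a * b' - x * (a' * b) ≤ (x - 1) * (x * (a' * b)) := by nlinarith
      have hB : x * (a * b' - x * (a' * b)) ≤ (x - 1) * (a * b') := by nlinarith
      have hx0 : 0 < x := by linarith
      have hu : 0 ≤ a * b' := by positivity
      have hv : 0 ≤ a' * b := by positivity
      have hm : (a * b' - x * (a' * b)) ^ 2 ≤ (x - 1) ^ 2 * ((a * b') * (a' * b)) := by
        have := mul_le_mul hA hB (by positivity)
          (mul_nonneg (by linarith) (by positivity))
        nlinarith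
      have hx2 : 0 ≤ (x - 1) := by linarith
      refine abs_le_of_sq_le_sq' ?_ (mul_nonneg hx2 (by positivity)) |>.2
      have h4 : 4 * ((a * b') * (a' * b)) ≤ (a * a' + b * b') ^ 2 := by
        nlinarith [sq_nonneg (a * a' - b * b')]
      have := mul_le_mul_of_nonneg_left h4 (sq_nonneg (x - 1))
      rw [mul_pow, mul_pow]
      linarith
  nlinarith

theorem stmt8 (m : ℕ) (hm : 0 < m) (α : ℝ) (hα : 0 < α) :
    let s : (Fin m → ℝ) → (Fin m → ℝ) := fun c j =>
      Real.exp (-c j / α) / ∑ k, Real.exp (-c k / α)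
    ∀ c₁ c₂ : Fin m → ℝ,
      (∑ j, |s c₁ j - s c₂ j|) ≤ 1 / α * ⨆ j, |c₁ j - c₂ j| := by
  intro s c₁ c₂
  have : Nonempty (Fin m) := ⟨⟨0, hm⟩⟩
  set D := ⨆ j, |c₁ j - c₂ j| with hD
  have hle : ∀ j, |c₁ j - c₂ j| ≤ D := fun j =>
    le_ciSup (f := fun j => |c₁ j - c₂ j|) (Set.finite_range _).bddAbove j
  have hD0 : 0 ≤ D := (abs_nonneg _).trans (hle ⟨0, hm⟩)
  have hS : ∀ c : Fin m → ℝ, 0 < ∑ k, Real.exp (-c k / α) := fun c =>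
    Finset.sum_pos (fun _ _ => Real.exp_pos _) Finset.univ_nonempty
  have hs1 : ∀ c, ∑ j, s c j = 1 := fun c => by
    simp only [s]
    rw [← Finset.sum_div, div_self (hS c).ne']
  have hE1 : ∀ j, Real.exp (-c₁ j / α) ≤ Real.exp (D / α) * Real.exp (-c₂ j / α) := fun j => by
    rw [← Real.exp_add, Real.exp_le_exp, ← add_div]
    gcongr
    linarith [neg_abs_le (c₁ j - c₂ j), hle j]
  have hE2 : ∀ j, Real.exp (-c₂ j / α) ≤ Real.exp (D / α) * Real.exp (-c₁ j / α) := fun j => by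
    rw [← Real.exp_add, Real.exp_le_exp, ← add_div]
    gcongr
    linarith [le_abs_self (c₁ j - c₂ j), hle j]
  let P : Fin m → Prop := fun j => 0 ≤ s c₁ j - s c₂ j
  classical
  have habs : ∑ j, |s c₁ j - s c₂ j| = 2 * ∑ j with P j, (s c₁ j - s c₂ j) := by
    have h0 : ∑ j, (s c₁ j - s c₂ j) = 0 := by
      rw [Finset.sum_sub_distrib, hs1, hs1, sub_self]
    have : ∀ j, |s c₁ j - s c₂ j| =
        2 * (if P j then (s c₁ j - s c₂ j) else 0) - (s c₁ j - s c₂ j) := fun j => by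
      by_cases h : P j
      · rw [if_pos h, abs_of_nonneg h]; ring
      · rw [if_neg h, abs_of_neg (not_le.mp h)]; ring
    rw [Finset.sum_congr rfl (fun j _ => this j), Finset.sum_sub_distrib, h0, sub_zero,
      ← Finset.mul_sum, Finset.sum_filter]
  have hsplit : ∀ c : Fin m → ℝ, ∑ j with P j, Real.exp (-c j / α)
      + ∑ j with ¬ P j, Real.exp (-c j / α) = ∑ k, Real.exp (-c k / α) := fun c =>
    Finset.sum_filter_add_sum_filter_not _ _ _
  have hnn : ∀ (c : Fin m → ℝ) (A : Finset (Fin m)), 0 ≤ ∑ j ∈ A, Real.exp (-c j / α) :=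
    fun c A => Finset.sum_nonneg fun _ _ => (Real.exp_pos _).le
  have := aux_two (∑ j with P j, Real.exp (-c₁ j / α)) (∑ j with ¬ P j, Real.exp (-c₁ j / α))
    (∑ j with P j, Real.exp (-c₂ j / α)) (∑ j with ¬ P j, Real.exp (-c₂ j / α)) (D / α)
    (by positivity) (hnn _ _) (hnn _ _) (hnn _ _) (hnn _ _)
    (by rw [hsplit]; exact hS _) (by rw [hsplit]; exact hS _)
    (by rw [Finset.mul_sum]; exact Finset.sum_le_sum fun j _ => hE1 j)
    (by rw [Finset.mul_sum]; exact Finset.sum_le_sum fun j _ => hE2 j)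
  rw [hsplit, hsplit, Finset.sum_div, Finset.sum_div, ← Finset.sum_sub_distrib] at this
  rw [habs, one_div_mul_eq_div]
  change ∑ j with P j, (s c₁ j - s c₂ j) ≤ _ at this
  linarith
end

section
/- Let π* be the unique minimizer of the primal objective F_α over Δ_m and let q* be any minimizer of the dual objective J_α over B_∞. Then (i) π* is the softmax of −Mᵀq*/α, i.e. π*_j = exp(−(Mᵀq*)_j/α) / Σ_{k=1}^m exp(−(Mᵀq*)_k/α) for all j; and (ii) Mπ* − p lies in the normal cone of B_∞ at q*, equivalently ⟨Mπ* − p, q*⟩ = ‖Mπ* − p‖_{ℓ¹}; in particular, q*_i = sign((Mπ* − p)_i) for every coordinate i with (Mπ* − p)_i ≠ 0. -/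
theorem aux_foc {m : ℕ} (hm : 0 < m) (a b : Fin m → ℝ) (c α : ℝ)
    (h : ∀ t : ℝ, 0 < t → t ≤ 1 → α * Real.log (∑ k, Real.exp (a k)) ≤
      t * c + α * Real.log (∑ k, Real.exp (a k + t * b k))) :
    0 ≤ c + α * ((∑ k, Real.exp (a k) * b k) / ∑ k, Real.exp (a k)) := by
  have hne : (Finset.univ : Finset (Fin m)).Nonempty := ⟨⟨0, hm⟩, Finset.mem_univ _⟩
  have hZ : 0 < ∑ k, Real.exp (a k) := Finset.sum_pos (fun k _ => Real.exp_pos _) hne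
  have h1 : HasDerivAt (fun t : ℝ => ∑ k, Real.exp (a k + t * b k))
      (∑ k, Real.exp (a k) * b k) 0 := by
    apply HasDerivAt.fun_sum
    intro k _
    have : HasDerivAt (fun t : ℝ => a k + t * b k) (b k) 0 := by
      simpa using ((hasDerivAt_id (0:ℝ)).mul_const (b k)).const_add (a k)
    simpa using this.exp
  have h2 := h1.log (by simpa using hZ.ne')
  have h3 : HasDerivAt (fun t : ℝ => t * c + α * Real.log (∑ k, Real.exp (a k + t * b k)))
      (c + α * ((∑ k, Real.exp (a k) * b k) / ∑ k, Real.exp (a k))) 0 := by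
    have := ((hasDerivAt_id (0:ℝ)).mul_const c).fun_add (h2.const_mul α)
    simpa using this
  have h4 := h3.tendsto_slope_zero_right
  refine ge_of_tendsto h4 ?_
  have : Set.Ioc (0:ℝ) 1 ∈ nhdsWithin (0:ℝ) (Set.Ioi 0) := Ioc_mem_nhdsGT one_pos
  filter_upwards [this] with t ht
  have := h t ht.1 ht.2
  simp only [zero_add, smul_eq_mul, zero_mul, add_zero]
  exact mul_nonneg (inv_nonneg.2 ht.1.le) (by linarith)

theorem aux_scalar (x y : ℝ) (hx : 0 ≤ x) (hy : 0 < y) :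
    0 ≤ x * Real.log x - x * Real.log y - x + y ∧
    (x * Real.log x - x * Real.log y - x + y = 0 → x = y) := by
  rcases hx.eq_or_lt with rfl | hx
  · simp [hy.le]; intro h; exact h.symm
  have e : x * Real.log x - x * Real.log y - x + y =
      x * ((y / x - 1) - Real.log (y / x)) := by
    rw [Real.log_div hy.ne' hx.ne']; field_simp; ring
  rw [e]
  refine ⟨mul_nonneg hx.le (by linarith [Real.log_le_sub_one_of_pos (div_pos hy hx)]), ?_⟩
  intro h
  by_contra hne
  have h1 : y / x ≠ 1 := by
    intro h2; rw [div_eq_one_iff_eq hx.ne'] at h2; exact hne h2.symm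
  have := Real.log_lt_sub_one_of_pos (div_pos hy hx) h1
  have := mul_pos hx (sub_pos.2 this)
  linarith

theorem aux_gibbs_s11 {m : ℕ} (x y : Fin m → ℝ) (hx : ∀ j, 0 ≤ x j) (hy : ∀ j, 0 < y j)
    (sx : ∑ j, x j = 1) (sy : ∑ j, y j = 1)
    (h : ∑ j, x j * Real.log (x j) ≤ ∑ j, x j * Real.log (y j)) : x = y := by
  have e : ∑ j, (x j * Real.log (x j) - x j * Real.log (y j) - x j + y j) ≤ 0 := by
    rw [Finset.sum_add_distrib, Finset.sum_sub_distrib, Finset.sum_sub_distrib, sx, sy]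
    linarith
  have e0 := le_antisymm e (Finset.sum_nonneg fun j _ => (aux_scalar _ _ (hx j) (hy j)).1)
  rw [Finset.sum_eq_zero_iff_of_nonneg
    (fun j _ => (aux_scalar _ _ (hx j) (hy j)).1)] at e0
  funext j
  exact (aux_scalar _ _ (hx j) (hy j)).2 (e0 j (Finset.mem_univ _))

theorem aux_adj {n m : ℕ} (M : Matrix (Fin n) (Fin m) ℝ) (x : Fin m → ℝ) (q : Fin n → ℝ) :
    ∑ i, M.mulVec x i * q i = ∑ k, x k * M.transpose.mulVec q k := by
  simp only [Matrix.mulVec, dotProduct, Matrix.transpose_apply, Finset.sum_mul, Finset.mul_sum]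
  rw [Finset.sum_comm]
  exact Finset.sum_congr rfl fun _ _ => Finset.sum_congr rfl fun _ _ => by ring


/-- primal–dual relationships. If `πs` minimizes the primal objective
`F_α(π) = ‖Mπ − p‖_{ℓ¹} + α ∑ π_j log π_j` over the simplex and `qs` minimizes the dual
objective `J_α(q) = ⟨p, q⟩ + α log(∑ exp(−(Mᵀq)_k/α))` over the unit `ℓ^∞` ball `B`, then
(i) `πs` is the softmax of `−Mᵀqs/α`; (ii) `M πs − p` lies in the normal cone of `B` at
`qs`, equivalently `⟨M πs − p, qs⟩ = ‖M πs − p‖_{ℓ¹}`; in particular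
`qs i = sign((M πs − p) i)` whenever `(M πs − p) i ≠ 0`. -/
theorem stmt11 (n m : ℕ) (hm : 0 < m)
    (M : Matrix (Fin n) (Fin m) ℝ) (p : Fin n → ℝ) (α : ℝ) (hα : 0 < α) :
    let F : (Fin m → ℝ) → ℝ := fun π =>
      (∑ i, |M.mulVec π i - p i|) + α * ∑ j, π j * Real.log (π j)
    let J : (Fin n → ℝ) → ℝ := fun q =>
      (∑ i, p i * q i) + α * Real.log (∑ k, Real.exp (-(M.transpose.mulVec q k) / α))
    let B : Set (Fin n → ℝ) := {q | ∀ i, |q i| ≤ 1}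
    ∀ πs ∈ stdSimplex ℝ (Fin m), (∀ π ∈ stdSimplex ℝ (Fin m), F πs ≤ F π) →
    ∀ qs ∈ B, (∀ q ∈ B, J qs ≤ J q) →
      (∀ j, πs j = Real.exp (-(M.transpose.mulVec qs j) / α) /
          ∑ k, Real.exp (-(M.transpose.mulVec qs k) / α)) ∧
      (∀ y ∈ B, ∑ i, (M.mulVec πs i - p i) * (y i - qs i) ≤ 0) ∧
      (∑ i, (M.mulVec πs i - p i) * qs i = ∑ i, |M.mulVec πs i - p i|) ∧
      (∀ i, M.mulVec πs i - p i ≠ 0 → qs i = Real.sign (M.mulVec πs i - p i)) := by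
  intro F J B πs hπ hF qs hq hJ
  have hne : (Finset.univ : Finset (Fin m)).Nonempty := ⟨⟨0, hm⟩, Finset.mem_univ _⟩
  set Z := ∑ k, Real.exp (-(M.transpose.mulVec qs k) / α) with hZdef
  have hZ : 0 < Z := Finset.sum_pos (fun k _ => Real.exp_pos _) hne
  set w : Fin m → ℝ := fun j => Real.exp (-(M.transpose.mulVec qs j) / α) / Z with hw
  have wpos : ∀ j, 0 < w j := fun j => div_pos (Real.exp_pos _) hZ
  have wsum : ∑ j, w j = 1 := by
    simp only [hw]; rw [← Finset.sum_div]; exact div_self hZ.ne'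
  -- normal cone for w
  have hN : ∀ y ∈ B, ∑ i, (M.mulVec w i - p i) * (y i - qs i) ≤ 0 := by
    intro y hy
    have key := aux_foc hm (fun k => -(M.transpose.mulVec qs k) / α)
      (fun k => -(M.transpose.mulVec (y - qs) k) / α) (∑ i, p i * (y i - qs i)) α (by
        intro t ht0 ht1
        have hb : qs + t • (y - qs) ∈ B := by
          intro i
          have h1 := abs_le.1 (hq i)
          have h2 := abs_le.1 (hy i)
          simp only [Pi.add_apply, Pi.smul_apply, Pi.sub_apply, smul_eq_mul]
          rw [abs_le]
          constructor <;> nlinarith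
        have := hJ _ hb
        simp only [J] at this
        have e1 : ∑ i, p i * (qs + t • (y - qs)) i
            = ∑ i, p i * qs i + t * ∑ i, p i * (y i - qs i) := by
          rw [Finset.mul_sum, ← Finset.sum_add_distrib]
          refine Finset.sum_congr rfl fun i _ => ?_
          simp only [Pi.add_apply, Pi.smul_apply, Pi.sub_apply, smul_eq_mul]; ring
        have e2 : ∀ k, -(M.transpose.mulVec (qs + t • (y - qs)) k) / α =
            -(M.transpose.mulVec qs k) / α + t * (-(M.transpose.mulVec (y - qs) k) / α) := by
          intro k
          rw [Matrix.mulVec_add, Matrix.mulVec_smul]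
          simp only [Pi.add_apply, Pi.smul_apply, smul_eq_mul]; ring
        rw [e1] at this
        simp only [e2] at this
        linarith)
    have e3 : α * ((∑ k, Real.exp (-(M.transpose.mulVec qs k) / α) *
        (-(M.transpose.mulVec (y - qs) k) / α)) / Z) = - ∑ i, M.mulVec w i * (y - qs) i := by
      rw [aux_adj, Finset.sum_div, Finset.mul_sum, ← Finset.sum_neg_distrib]
      refine Finset.sum_congr rfl fun k _ => ?_
      simp only [hw]; field_simp
    have e4 : ∑ i, (M.mulVec w i - p i) * (y i - qs i) =
        ∑ i, M.mulVec w i * (y - qs) i - ∑ i, p i * (y i - qs i) := by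
      rw [← Finset.sum_sub_distrib]
      exact Finset.sum_congr rfl fun i _ => by simp only [Pi.sub_apply]; ring
    rw [e4]
    linarith [key, e3]
  have hle : ∀ v : Fin n → ℝ, ∀ i, v i * qs i ≤ |v i| := by
    intro v i
    calc v i * qs i ≤ |v i * qs i| := le_abs_self _
      _ = |v i| * |qs i| := abs_mul _ _
      _ ≤ |v i| * 1 := mul_le_mul_of_nonneg_left (hq i) (abs_nonneg _)
      _ = |v i| := mul_one _
  have hsm : ∀ v : ℝ, v * Real.sign v = |v| := by
    intro v
    rcases lt_trichotomy v 0 with h | h | h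
    · rw [Real.sign_of_neg h, abs_of_neg h]; ring
    · simp [h]
    · rw [Real.sign_of_pos h, abs_of_pos h]; ring
  have hE : ∑ i, (M.mulVec w i - p i) * qs i = ∑ i, |M.mulVec w i - p i| := by
    apply le_antisymm (Finset.sum_le_sum fun i _ => hle (fun i => M.mulVec w i - p i) i)
    have := hN (fun i => Real.sign (M.mulVec w i - p i)) (by
      intro i
      rcases Real.sign_apply_eq (M.mulVec w i - p i) with h | h | h <;> simp [h])
    simp only [mul_sub, hsm, Finset.sum_sub_distrib] at this
    linarith
  have hlin : ∀ x : Fin m → ℝ, ∑ j, x j = 1 → ∑ i, (M.mulVec x i - p i) * qs i =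
      - α * ∑ j, x j * Real.log (w j) - α * Real.log Z - ∑ i, p i * qs i := by
    intro x hx
    simp only [sub_mul, Finset.sum_sub_distrib]
    rw [aux_adj]
    have : ∀ j, M.transpose.mulVec qs j = -α * Real.log (w j) - α * Real.log Z := by
      intro j
      simp only [hw]
      rw [Real.log_div (Real.exp_pos _).ne' hZ.ne', Real.log_exp]
      field_simp; ring
    simp only [this, mul_sub, Finset.sum_sub_distrib]
    rw [← Finset.sum_mul, hx, Finset.mul_sum]
    congr 1
    rw [one_mul]
    congr 1
    exact Finset.sum_congr rfl fun i _ => by ring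
  have hwπ : πs = w := by
    apply aux_gibbs_s11 πs w hπ.1 wpos hπ.2 wsum
    have h1 := hF w ⟨fun j => (wpos j).le, wsum⟩
    simp only [F] at h1
    rw [← hE, hlin w wsum] at h1
    have h2 : ∑ i, (M.mulVec πs i - p i) * qs i ≤ ∑ i, |M.mulVec πs i - p i| :=
      Finset.sum_le_sum fun i _ => hle (fun i => M.mulVec πs i - p i) i
    rw [hlin πs hπ.2] at h2
    refine le_of_mul_le_mul_left ?_ hα
    linarith
  rw [hwπ]
  refine ⟨fun j => rfl, hN, hE, ?_⟩
  intro i hi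
  have h0 := (Finset.sum_eq_sum_iff_of_le
    (fun i _ => hle (fun i => M.mulVec w i - p i) i)).1 hE i (Finset.mem_univ _)
  rw [← hsm] at h0
  exact mul_left_cancel₀ hi h0
end

section
/- Let ‖·‖ be a norm on R^n, A ∈ R^{m×n}, and σ > 0. Let g : R^n → R be differentiable and σ-strongly convex with respect to ‖·‖, and let f : R^m → R ∪ {+∞} be proper, closed and convex. Define the dual objective D(y) = f*(y) + g*(−Aᵀy) for y ∈ R^m and, for each y, set x(y) = ∇g*(−Aᵀy) (well defined since g* is finite and differentiable on all of R^n). Suppose y* minimizes D over R^m, that f* is differentiable at y*, and set x* = ∇g*(−Aᵀy*) (which is the unique minimizer of the primal x ↦ f(Ax) + g(x)). Then for every y ∈ R^m with D(y) < +∞: ‖x(y) − x*‖² ≤ (2/σ) ( D(y) − D(y*) ). -/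
/-- Euclidean dot product on `Fin d → ℝ`. -/
noncomputable def dot {d : ℕ} (x y : Fin d → ℝ) : ℝ := ∑ i, x i * y i


lemma dot_eq {d : ℕ} (x y : Fin d → ℝ) : dot x y = x ⬝ᵥ y := rfl

lemma dot_cont {d : ℕ} (z : Fin d → ℝ) : Continuous (fun x => dot z x) := by
  unfold dot; fun_prop

lemma dot_abs_le {d : ℕ} (x y : Fin d → ℝ) : |dot x y| ≤ d * (‖x‖ * ‖y‖) := by
  unfold dot
  calc |∑ i, x i * y i| ≤ ∑ i, |x i * y i| := Finset.abs_sum_le_sum_abs _ _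
    _ ≤ ∑ i : Fin d, ‖x‖ * ‖y‖ := by
        apply Finset.sum_le_sum
        intro i _
        rw [abs_mul]
        exact mul_le_mul (norm_le_pi_norm x i) (norm_le_pi_norm y i) (abs_nonneg _) (norm_nonneg _)
    _ = _ := by simp

section
variable {n : ℕ} {N : (Fin n → ℝ) → ℝ}

lemma N_nonneg (hN0 : ∀ x, N x = 0 ↔ x = 0)
    (hNsmul : ∀ (a : ℝ) (x), N (a • x) = |a| * N x)
    (hNadd : ∀ x y, N (x + y) ≤ N x + N y) (x) : 0 ≤ N x := by
  have h1 := hNadd x ((-1 : ℝ) • x)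
  rw [hNsmul] at h1
  have : x + (-1 : ℝ) • x = 0 := by simp
  rw [this, (hN0 0).2 rfl] at h1
  simp at h1
  linarith

lemma N_lower (hN0 : ∀ x, N x = 0 ↔ x = 0)
    (hNsmul : ∀ (a : ℝ) (x), N (a • x) = |a| * N x)
    (hNadd : ∀ x y, N (x + y) ≤ N x + N y) : ∃ c > 0, ∀ x, c * ‖x‖ ≤ N x := by
  have hconv : ConvexOn ℝ Set.univ N := by
    refine ⟨convex_univ, ?_⟩
    intro x _ y _ a b ha hb _
    have := hNadd (a • x) (b • y)
    rw [hNsmul, hNsmul, abs_of_nonneg ha, abs_of_nonneg hb] at this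
    simpa using this
  have hc : Continuous N := by
    have := hconv.continuousOn_interior
    simpa [continuousOn_univ] using this
  rcases (Metric.sphere (0 : Fin n → ℝ) 1).eq_empty_or_nonempty with he | hne
  · refine ⟨1, one_pos, fun x => ?_⟩
    by_cases hx : x = 0
    · subst hx; simp [(hN0 0).2 rfl]
    · exfalso
      have : (‖x‖⁻¹ • x) ∈ Metric.sphere (0 : Fin n → ℝ) 1 := by
        simp [norm_smul, hx]
      rw [he] at this; exact this
  · obtain ⟨u, hu, hmin⟩ := (isCompact_sphere (0 : Fin n → ℝ) 1).exists_isMinOn hne hc.continuousOn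
    have hu1 : ‖u‖ = 1 := by simpa using hu
    have hupos : 0 < N u := by
      refine lt_of_le_of_ne (N_nonneg hN0 hNsmul hNadd u) (fun h => ?_)
      have := (hN0 u).1 h.symm
      rw [this] at hu1; simp at hu1
    refine ⟨N u, hupos, fun x => ?_⟩
    by_cases hx : x = 0
    · subst hx; simp [(hN0 0).2 rfl]
    · have hm : (‖x‖⁻¹ • x) ∈ Metric.sphere (0 : Fin n → ℝ) 1 := by
        simp [norm_smul, hx]
      have h2 : N u ≤ N (‖x‖⁻¹ • x) := hmin hm
      have hp : 0 < ‖x‖ := norm_pos_iff.2 hx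
      rw [hNsmul, abs_of_pos (inv_pos.2 hp), inv_mul_eq_div, le_div_iff₀ hp] at h2
      exact h2

lemma g_attain (hN0 : ∀ x, N x = 0 ↔ x = 0)
    (hNsmul : ∀ (a : ℝ) (x), N (a • x) = |a| * N x)
    (hNadd : ∀ x y, N (x + y) ≤ N x + N y)
    {σ : ℝ} (hσ : 0 < σ) {g : (Fin n → ℝ) → ℝ} (hg : Continuous g)
    (hstrong : ∀ x y : Fin n → ℝ, ∀ t ∈ Set.Icc (0 : ℝ) 1,
      g (t • x + (1 - t) • y) ≤ t * g x + (1 - t) * g y - σ / 2 * t * (1 - t) * N (x - y) ^ 2)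
    (z : Fin n → ℝ) :
    ∃ x, ∀ w, g x - dot z x + σ / 2 * N (w - x) ^ 2 ≤ g w - dot z w := by
  obtain ⟨c, hc, hcN⟩ := N_lower hN0 hNsmul hNadd
  set h : (Fin n → ℝ) → ℝ := fun w => g w - dot z w with hh
  have hhc : Continuous h := hg.sub (dot_cont z)
  have hs : ∀ x y : Fin n → ℝ, ∀ t ∈ Set.Icc (0 : ℝ) 1,
      h (t • x + (1 - t) • y) ≤ t * h x + (1 - t) * h y - σ / 2 * t * (1 - t) * N (x - y) ^ 2 := by
    intro x y t ht
    have := hstrong x y t ht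
    simp only [hh, dot_eq, dotProduct_add, dotProduct_smul, smul_eq_mul]
    linarith
  obtain ⟨M, hM⟩ : ∃ M, ∀ w ∈ Metric.closedBall (0 : Fin n → ℝ) 1, M ≤ h w := by
    obtain ⟨M, hM⟩ := ((isCompact_closedBall (0 : Fin n → ℝ) 1).image hhc).bddBelow
    exact ⟨M, fun w hw => hM ⟨w, hw, rfl⟩⟩
  obtain ⟨x, hx⟩ : ∃ x, ∀ w, h x ≤ h w := by
    apply hhc.exists_forall_le' 0
    have hev : ∀ᶠ w in Filter.cocompact (Fin n → ℝ), max 2 (4 * (h 0 - M) / (σ * c ^ 2)) ≤ ‖w‖ :=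
      (tendsto_norm_cocompact_atTop (E := Fin n → ℝ)).eventually_ge_atTop _
    filter_upwards [hev] with w hw
    have hr2 : 2 ≤ ‖w‖ := (le_max_left _ _).trans hw
    have hrK : 4 * (h 0 - M) / (σ * c ^ 2) ≤ ‖w‖ := (le_max_right _ _).trans hw
    rw [div_le_iff₀ (by positivity)] at hrK
    set r := ‖w‖ with hr
    have hr0 : 0 < r := by linarith
    have hinv : r⁻¹ ≤ 1 / 2 := by
      rw [inv_le_comm₀ hr0 (by norm_num)]; norm_num; exact hr2
    have h1 := hs w 0 r⁻¹ ⟨by positivity, by linarith⟩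
    have h2 : M ≤ h (r⁻¹ • w + (1 - r⁻¹) • 0) := by
      apply hM
      simp [norm_smul, ← hr, abs_of_pos hr0, hr0.ne']
    have h3 : (c * r) ^ 2 ≤ N (w - 0) ^ 2 := by
      rw [sub_zero]
      exact pow_le_pow_left₀ (by positivity) (hcN w) 2
    have h4 : σ / 2 * r⁻¹ * (1 / 2) * (c * r) ^ 2 ≤ σ / 2 * r⁻¹ * (1 - r⁻¹) * N (w - 0) ^ 2 := by
      apply mul_le_mul _ h3 (by positivity) 
      · apply mul_nonneg (by positivity); linarith
      · apply mul_le_mul_of_nonneg_left _ (by positivity); linarith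
    have h5 : σ / 2 * r⁻¹ * (1 / 2) * (c * r) ^ 2 = r * (σ * c ^ 2) / 4 := by
      field_simp; ring
    have h6 : 0 ≤ r⁻¹ * (h w - h 0) := by nlinarith
    have h7 := nonneg_of_mul_nonneg_right h6 (inv_pos.2 hr0)
    linarith
  refine ⟨x, fun w => ?_⟩
  change h x + _ ≤ h w
  have key : ∀ t ∈ Set.Ioo (0 : ℝ) 1, h x + σ / 2 * (1 - t) * N (w - x) ^ 2 ≤ h w := by
    intro t ht
    have h1 := hs w x t ⟨ht.1.le, ht.2.le⟩
    have h2 := hx (t • w + (1 - t) • x)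
    have : 0 ≤ t * (h w - (h x + σ / 2 * (1 - t) * N (w - x) ^ 2)) := by linarith
    have := nonneg_of_mul_nonneg_right this ht.1
    linarith
  have hlim : Filter.Tendsto (fun t : ℝ => h x + σ / 2 * (1 - t) * N (w - x) ^ 2)
      (nhdsWithin 0 (Set.Ioi 0)) (nhds (h x + σ / 2 * (1 - 0) * N (w - x) ^ 2)) := by
    apply Filter.Tendsto.mono_left _ nhdsWithin_le_nhds
    apply Continuous.tendsto (f := fun t : ℝ => h x + σ / 2 * (1 - t) * N (w - x) ^ 2)
    fun_prop
  have := le_of_tendsto hlim (Filter.mem_of_superset (Ioo_mem_nhdsGT one_pos) key)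
  simpa using this

end

/-- `dot · x` as a continuous linear map. -/
noncomputable def dotL {d : ℕ} (x : Fin d → ℝ) : (Fin d → ℝ) →L[ℝ] ℝ :=
  LinearMap.toContinuousLinearMap
    { toFun := fun z => dot z x
      map_add' := fun a b => by simp [dot_eq, add_dotProduct]
      map_smul' := fun a b => by simp [dot_eq, smul_dotProduct] }

lemma dotL_apply {d : ℕ} (x z : Fin d → ℝ) : dotL x z = dot z x := rfl

/-- Gradient of the conjugate. -/
lemma gstar_hasFDerivAt {n : ℕ} {N : (Fin n → ℝ) → ℝ} (hN0 : ∀ x, N x = 0 ↔ x = 0)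
    (hNsmul : ∀ (a : ℝ) (x), N (a • x) = |a| * N x)
    (hNadd : ∀ x y, N (x + y) ≤ N x + N y)
    {σ : ℝ} (hσ : 0 < σ) {g gs : (Fin n → ℝ) → ℝ} {X : (Fin n → ℝ) → (Fin n → ℝ)}
    (hX : ∀ z w, g (X z) - dot z (X z) + σ / 2 * N (w - X z) ^ 2 ≤ g w - dot z w)
    (hgs : ∀ z, gs z = dot z (X z) - g (X z)) (z : Fin n → ℝ) :
    HasFDerivAt gs (dotL (X z)) z := by
  obtain ⟨c, hc, hcN⟩ := N_lower hN0 hNsmul hNadd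
  have hlow : ∀ z', 0 ≤ gs z' - gs z - dotL (X z) (z' - z) := by
    intro z'
    have h1 := hX z' (X z)
    have : 0 ≤ σ / 2 * N (X z - X z') ^ 2 := by positivity
    rw [hgs, hgs, dotL_apply]
    simp only [dot_eq, sub_dotProduct] at *
    linarith
  have hup : ∀ z', gs z' - gs z - dotL (X z) (z' - z) ≤ ((n / c) ^ 2 / (2 * σ)) * ‖z' - z‖ ^ 2 := by
    intro z'
    have h1 := hX z (X z')
    have h2 : dot (z' - z) (X z' - X z) ≤ (n / c * ‖z' - z‖) * N (X z' - X z) := by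
      refine (le_abs_self _).trans ((dot_abs_le _ _).trans ?_)
      have := hcN (X z' - X z)
      have h3 : ‖X z' - X z‖ ≤ N (X z' - X z) / c := by
        rw [le_div_iff₀ hc]; linarith
      calc (n : ℝ) * (‖z' - z‖ * ‖X z' - X z‖) ≤ n * (‖z' - z‖ * (N (X z' - X z) / c)) := by gcongr
        _ = _ := by ring
    have h3 : (n / c * ‖z' - z‖) * N (X z' - X z) - σ / 2 * N (X z' - X z) ^ 2 
       ≤ ((n / c) ^ 2 / (2 * σ)) * ‖z' - z‖ ^ 2 := by
      generalize N (X z' - X z) = a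
      have e : ((n / c) ^ 2 / (2 * σ)) * ‖z' - z‖ ^ 2 - ((n / c * ‖z' - z‖) * a - σ / 2 * a ^ 2)
        = (n / c * ‖z' - z‖ - σ * a) ^ 2 / (2 * σ) := by
        field_simp; ring
      have : 0 ≤ (n / c * ‖z' - z‖ - σ * a) ^ 2 / (2 * σ) := by positivity
      linarith
    rw [hgs, hgs, dotL_apply]
    simp only [dot_eq, sub_dotProduct, dotProduct_sub] at *
    linarith
  rw [hasFDerivAt_iff_isLittleO]
  have hO : (fun z' => gs z' - gs z - dotL (X z) (z' - z)) =O[nhds z] fun z' => ‖z' - z‖ ^ 2 := by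
    apply Asymptotics.IsBigO.of_bound ((n / c) ^ 2 / (2 * σ))
    filter_upwards with z'
    rw [Real.norm_of_nonneg (hlow z'), Real.norm_of_nonneg (by positivity)]
    exact hup z'
  refine hO.trans_isLittleO ?_
  exact Asymptotics.isLittleO_pow_sub_sub z one_lt_two

/-- Conjugate differentiable at `y` with gradient `v` and `f` lsc: `f v ≤ ⟨y,v⟩ - f* y`. -/
lemma conj_attain {m : ℕ} {f : (Fin m → ℝ) → EReal} (hfclosed : LowerSemicontinuous f)
    {F : (Fin m → ℝ) → ℝ} {y v : Fin m → ℝ}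
    (hF : ∀ᶠ y' in nhds y, IsLUB (Set.range fun z => ((dot y' z : ℝ) : EReal) - f z) (F y' : EReal))
    (hd : HasFDerivAt F (dotL v) y) : f v ≤ ((dot y v - F y : ℝ) : EReal) := by
  -- approximate maximizers are close to v
  have hclose : ∀ ε > 0, ∃ η > 0, ∀ z, ((F y - η : ℝ) : EReal) ≤ (dot y z : ℝ) - f z →
      ‖z - v‖ ≤ ε := by
    intro ε hε
    have hb := (hasFDerivAt_iff_isLittleO.1 hd).def (show 0 < ε / 2 by positivity)
    obtain ⟨δ, hδ, hball⟩ := Metric.eventually_nhds_iff.1 (hF.and hb)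
    refine ⟨ε / 2 * (δ / 2), by positivity, fun z hz => ?_⟩
    rw [pi_norm_le_iff_of_nonneg hε.le]
    have main : ∀ i, ∀ s : ℝ, |s| = 1 → s * (z i - v i) ≤ ε := by
      intro i s hs
      set p : Fin m → ℝ := Pi.single i (s * (δ / 2)) with hp
      have hpn : ‖p‖ = δ / 2 := by
        rw [hp, Pi.norm_single, norm_mul, Real.norm_eq_abs, hs, one_mul,
          Real.norm_of_nonneg (by positivity)]
      have hpd : ∀ u, dot p u = s * (δ / 2) * u i := by
        intro u; rw [dot_eq, hp, single_dotProduct]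
      obtain ⟨hl, hb'⟩ := hball (y := y + p) (by rw [dist_eq_norm]; simp [hpn]; linarith)
      have h1 : ((dot (y + p) z : ℝ) : EReal) - f z ≤ (F (y + p) : EReal) := hl.1 ⟨z, rfl⟩
      have h2 : F y - ε / 2 * (δ / 2) + dot p z ≤ F (y + p) := by
        have e : dot (y + p) z = dot y z + dot p z := by simp [dot_eq, add_dotProduct]
        rw [e] at h1
        induction hfz : f z using EReal.rec with
        | bot => rw [hfz] at h1; simp at h1
        | top => rw [hfz, EReal.sub_top, le_bot_iff] at hz; exact absurd hz (EReal.coe_ne_bot _)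
        | coe q =>
          rw [hfz] at h1 hz
          norm_cast at h1 hz
          linarith
      have h3 := (le_abs_self _).trans hb'
      rw [add_sub_cancel_left, hpn, dotL_apply, hpd] at h3
      rw [hpd] at h2
      have : (δ / 2) * (s * (z i - v i)) ≤ (δ / 2) * ε := by nlinarith
      exact le_of_mul_le_mul_left this (by positivity)
    intro i
    rw [Pi.sub_apply, Real.norm_eq_abs, abs_le]
    have a1 := main i 1 (by simp)
    have a2 := main i (-1) (by simp)
    constructor <;> linarith
  by_contra hcon
  push Not at hcon
  obtain ⟨q, hq1, hq2⟩ := EReal.lt_iff_exists_real_btwn.1 hcon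
  have hq1 : dot y v - F y < q := by exact_mod_cast hq1
  have ev1 := hfclosed v q hq2
  have ev2 : ∀ᶠ z in nhds v, dot y z < q + F y - (q - (dot y v - F y)) / 2 :=
    (dot_cont y).continuousAt.eventually_lt continuousAt_const (by linarith)
  obtain ⟨ε, hε, hball⟩ := Metric.eventually_nhds_iff.1 (ev1.and ev2)
  obtain ⟨η, hη, hcl⟩ := hclose (ε / 2) (by positivity)
  set η' := min η ((q - (dot y v - F y)) / 2) with hη'
  have hη'0 : 0 < η' := lt_min hη (by linarith)
  have hlub := hF.self_of_nhds
  have : ((F y - η' : ℝ) : EReal) < F y := by exact_mod_cast (by linarith)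
  obtain ⟨_, ⟨z, rfl⟩, hz⟩ := (lt_isLUB_iff hlub).1 this
  have hzv := hcl z (le_trans (by exact_mod_cast (by linarith [min_le_left η ((q - (dot y v - F y)) / 2)])) hz.le)
  obtain ⟨b1, b2⟩ := hball (y := z) (by rw [dist_eq_norm]; linarith)
  have hm := min_le_right η ((q - (dot y v - F y)) / 2)
  dsimp only at hz
  induction hfz : f z using EReal.rec with
  | bot => rw [hfz] at b1; simp at b1
  | top => rw [hfz] at hz; simp at hz
  | coe r =>
    rw [hfz] at hz b1
    norm_cast at hz b1
    linarith


/-- general primal recovery bound from the dual gap. Let `‖·‖ = N` be a norm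
on `R^n`, `A ∈ R^{m×n}`, `g : R^n → R` differentiable and `σ`-strongly convex w.r.t. `N`,
and `f : R^m → R ∪ {+∞}` proper, closed and convex (encoded with values in `EReal`, never
`⊥`). With `g*(z) = sup_x (⟨z,x⟩ − g(x))`, `f*(y) = sup_z (⟨y,z⟩ − f(z))`,
`D(y) = f*(y) + g*(−Aᵀy)` and `x(y) = ∇g*(−Aᵀy)`, if `y*` minimizes `D` and `f*` is
(finite and) differentiable at `y*`, then `x* = x(y*)` is the unique minimizer of the
primal `x ↦ f(Ax) + g(x)` and for every `y` with `D(y) < +∞`,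
`N(x(y) − x*)² ≤ (2/σ)(D(y) − D(y*))`. -/
theorem stmt13 (n m : ℕ)
    (N : (Fin n → ℝ) → ℝ)
    (hN0 : ∀ x, N x = 0 ↔ x = 0)
    (hNsmul : ∀ (a : ℝ) (x), N (a • x) = |a| * N x)
    (hNadd : ∀ x y, N (x + y) ≤ N x + N y)
    (A : Matrix (Fin m) (Fin n) ℝ)
    (σ : ℝ) (hσ : 0 < σ)
    (g : (Fin n → ℝ) → ℝ) (hg : Differentiable ℝ g)
    (hstrong : ∀ x y : Fin n → ℝ, ∀ t ∈ Set.Icc (0 : ℝ) 1,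
      g (t • x + (1 - t) • y) ≤ t * g x + (1 - t) * g y - σ / 2 * t * (1 - t) * N (x - y) ^ 2)
    (f : (Fin m → ℝ) → EReal)
    (hfnebot : ∀ z, f z ≠ ⊥) (hfproper : ∃ z, f z ≠ ⊤)
    (hfconv : ∀ z w : Fin m → ℝ, ∀ t ∈ Set.Icc (0 : ℝ) 1,
      f (t • z + (1 - t) • w) ≤ (t : EReal) * f z + ((1 - t : ℝ) : EReal) * f w)
    (hfclosed : LowerSemicontinuous f) :
    let gstar : (Fin n → ℝ) → ℝ := fun z => sSup {r : ℝ | ∃ x, r = dot z x - g x}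
    let fstar : (Fin m → ℝ) → EReal := fun y => ⨆ z, ((dot y z : ℝ) : EReal) - f z
    let D : (Fin m → ℝ) → EReal := fun y =>
      fstar y + ((gstar (-(A.transpose.mulVec y)) : ℝ) : EReal)
    let xmap : (Fin m → ℝ) → (Fin n → ℝ) := fun y i =>
      fderiv ℝ gstar (-(A.transpose.mulVec y)) (Pi.single i 1)
    ∀ ystar : Fin m → ℝ, (∀ y, D ystar ≤ D y) →
      (∀ᶠ y in nhds ystar, fstar y ≠ ⊤) →
      DifferentiableAt ℝ (fun y => (fstar y).toReal) ystar →
      (∀ x : Fin n → ℝ,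
          ((g (xmap ystar) : ℝ) : EReal) + f (A.mulVec (xmap ystar)) ≤
            ((g x : ℝ) : EReal) + f (A.mulVec x)) ∧
      (∀ x : Fin n → ℝ,
          ((g x : ℝ) : EReal) + f (A.mulVec x) =
            ((g (xmap ystar) : ℝ) : EReal) + f (A.mulVec (xmap ystar)) → x = xmap ystar) ∧
      (∀ y : Fin m → ℝ, D y ≠ ⊤ →
        N (xmap y - xmap ystar) ^ 2 ≤ 2 / σ * ((D y).toReal - (D ystar).toReal)) := by
  intro gstar fstar D xmap ystar hmin hfin hdiff
  choose X hX using fun z => g_attain hN0 hNsmul hNadd hσ hg.continuous hstrong z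
  have hgs : ∀ z, gstar z = dot z (X z) - g (X z) := by
    intro z
    apply IsGreatest.csSup_eq
    refine ⟨⟨X z, rfl⟩, ?_⟩
    rintro _ ⟨w, rfl⟩
    have := hX z w
    have : 0 ≤ σ / 2 * N (w - X z) ^ 2 := by positivity
    linarith
  have hgd : ∀ z, HasFDerivAt gstar (dotL (X z)) z :=
    gstar_hasFDerivAt hN0 hNsmul hNadd hσ hX hgs
  have hxm : ∀ y, xmap y = X (-(A.transpose.mulVec y)) := by
    intro y
    funext i
    change fderiv ℝ gstar _ _ = _
    rw [(hgd _).fderiv, dotL_apply, dot_eq, single_dotProduct, one_mul]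
  have hadj : ∀ y x, dot (-(A.transpose.mulVec y)) x = - dot y (A.mulVec x) := by
    intro y x
    rw [dot_eq, dot_eq, neg_dotProduct, Matrix.mulVec_transpose, Matrix.dotProduct_mulVec]
  have hfbot : ∀ y, fstar y ≠ ⊥ := by
    intro y hy
    obtain ⟨z, hz⟩ := hfproper
    have h1 : ((dot y z : ℝ) : EReal) - f z ≤ fstar y :=
      le_iSup (fun z => ((dot y z : ℝ) : EReal) - f z) z
    rw [hy] at h1
    lift f z to ℝ using ⟨hz, hfnebot z⟩ with q
    norm_cast at h1
  set F : (Fin m → ℝ) → ℝ := fun y => (fstar y).toReal with hFdef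
  have hFc : ∀ y, fstar y ≠ ⊤ → (F y : EReal) = fstar y := fun y hy =>
    EReal.coe_toReal hy (hfbot y)
  have hDc : ∀ y, fstar y ≠ ⊤ → D y = ((F y + gstar (-(A.transpose.mulVec y)) : ℝ) : EReal) := by
    intro y hy
    change fstar y + _ = _
    rw [← hFc y hy, EReal.coe_add]
  have hys := hfin.self_of_nhds
  set xs := X (-(A.transpose.mulVec ystar)) with hxs
  -- gradient of f*
  let L : (Fin m → ℝ) →L[ℝ] (Fin n → ℝ) :=
    LinearMap.toContinuousLinearMap (-(Matrix.mulVecLin A.transpose))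
  have hL : ∀ y, L y = -(A.transpose.mulVec y) := fun y => rfl
  have hFd : HasFDerivAt F (dotL (A.mulVec xs)) ystar := by
    have h1 : HasFDerivAt (fun y => gstar (L y)) ((dotL xs).comp L) ystar :=
      HasFDerivAt.comp ystar (hgd (L ystar)) L.hasFDerivAt
    have h2 := hdiff.hasFDerivAt.add h1
    have h3 : IsLocalMin (F + fun y => gstar (L y)) ystar := by
      filter_upwards [hfin] with y hy
      have := hmin y
      rw [hDc y hy, hDc ystar hys] at this
      exact_mod_cast this
    have h4 := h3.hasFDerivAt_eq_zero h2
    have h5 : fderiv ℝ F ystar = dotL (A.mulVec xs) := by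
      ext1 y
      have := congrArg (fun T => T y) h4
      simp only [ContinuousLinearMap.add_apply, ContinuousLinearMap.comp_apply, hL, dotL_apply,
        hadj, ContinuousLinearMap.zero_apply] at this
      rw [dotL_apply]
      linarith
    rw [← h5]
    exact hdiff.hasFDerivAt
  have hatt : f (A.mulVec xs) ≤ ((dot ystar (A.mulVec xs) - F ystar : ℝ) : EReal) := by
    apply conj_attain hfclosed _ hFd
    filter_upwards [hfin] with y hy
    rw [hFc y hy]
    exact isLUB_iSup
  have hyoung : ∀ y z, fstar y ≠ ⊤ → ∀ q : ℝ, f z ≤ q → dot y z - q ≤ F y := by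
    intro y z hy q hq
    have h1 : ((dot y z : ℝ) : EReal) - f z ≤ fstar y :=
      le_iSup (fun z => ((dot y z : ℝ) : EReal) - f z) z
    rw [← hFc y hy] at h1
    have h2 : ((dot y z : ℝ) : EReal) - (q : EReal) ≤ F y :=
      (EReal.sub_le_sub le_rfl hq).trans h1
    exact_mod_cast h2
  have hattlow : ((dot ystar (A.mulVec xs) - F ystar : ℝ) : EReal) = f (A.mulVec xs) := by
    refine le_antisymm ?_ hatt
    induction hq : f (A.mulVec xs) using EReal.rec with
    | bot => exact absurd hq (hfnebot _)
    | top => exact le_top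
    | coe q =>
      have := hyoung ystar _ hys q hq.le
      exact_mod_cast (by linarith)
  have hprimal : ∀ x, ∀ q : ℝ, f (A.mulVec x) = q →
      g xs + (dot ystar (A.mulVec xs) - F ystar) + σ / 2 * N (x - xs) ^ 2 ≤ g x + q := by
    intro x q hq
    have h1 := hyoung ystar _ hys q hq.le
    have h2 := hX (-(A.transpose.mulVec ystar)) x
    rw [← hxs, hadj, hadj] at h2
    linarith
  simp only [hxm]
  rw [← hxs]
  refine ⟨?_, ?_, ?_⟩
  · intro x
    rw [← hattlow]
    induction hq : f (A.mulVec x) using EReal.rec with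
    | bot => exact absurd hq (hfnebot _)
    | top => simp
    | coe q =>
      have h1 := hprimal x q hq
      have : 0 ≤ σ / 2 * N (x - xs) ^ 2 := by positivity
      exact_mod_cast (by linarith)
  · intro x hx
    rw [← hattlow] at hx
    induction hq : f (A.mulVec x) using EReal.rec with
    | bot => exact absurd hq (hfnebot _)
    | top => 
      rw [hq, ← EReal.coe_add] at hx
      simp only [EReal.coe_add_top] at hx
      exact absurd hx.symm (EReal.coe_ne_top _)
    | coe q =>
      have h1 := hprimal x q hq
      rw [hq] at hx
      have hx' : g x + q = g xs + (dot ystar (A.mulVec xs) - F ystar) := by exact_mod_cast hx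
      have h2 : σ / 2 * N (x - xs) ^ 2 ≤ 0 := by linarith
      have h3 : N (x - xs) ^ 2 ≤ 0 := by
        by_contra hc
        push Not at hc
        have : 0 < σ / 2 * N (x - xs) ^ 2 := by positivity
        linarith
      have h4 : N (x - xs) = 0 := by nlinarith [sq_nonneg (N (x - xs))]
      exact sub_eq_zero.1 ((hN0 _).1 h4)
  · intro y hDy
    have hy : fstar y ≠ ⊤ := by
      intro h
      apply hDy
      change fstar y + _ = _
      rw [h, EReal.top_add_coe]
    rw [hDc y hy, hDc ystar hys, EReal.toReal_coe, EReal.toReal_coe, hgs, hgs, ← hxs]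
    have h1 := hyoung y _ hy _ hatt
    have h2 := hX (-(A.transpose.mulVec y)) xs
    set xy := X (-(A.transpose.mulVec y))
    have hsym : N (xy - xs) = N (xs - xy) := by
      have := hNsmul (-1) (xs - xy)
      simpa using this
    rw [hsym, div_mul_eq_mul_div, le_div_iff₀ hσ]
    rw [hadj, hadj] at *
    linarith
end

section
/- Let n ≥ 1 and p' ∈ (1, 2], and define d_{p'}(x) = (1/2) ‖x‖_{ℓ^{p'}}² on R^n. Then: (i) for every p ∈ [p', ∞], d_{p'} is (p'−1)-strongly convex with respect to the ℓ^p norm; and (ii) for every p ∈ [1, p'], d_{p'} is (p'−1) n^{2(1/p'−1/p)}-strongly convex with respect to the ℓ^p norm. -/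
open scoped ENNReal

lemma aux_deriv_s14 (s : ℝ) (hs0 : 0 < s) (hs1 : s ≤ 1) (x : ℝ) (hx0 : 0 ≤ x) (hx1 : x < 1) :
    2 ≤ (1 + x) ^ (s - 1) + (1 - x) ^ (s - 1) := by
  have h1 : 0 < 1 + x := by linarith
  have h2 : 0 < 1 - x := by linarith
  have e1 : 0 < (1 + x) ^ (s - 1) := by positivity
  have e2 : 0 < (1 - x) ^ (s - 1) := by positivity
  have h : 1 ≤ (1 + x) ^ (s - 1) * (1 - x) ^ (s - 1) := by
    rw [← Real.mul_rpow h1.le h2.le]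
    exact Real.one_le_rpow_of_pos_of_le_one_of_nonpos (by positivity) (by nlinarith) (by linarith)
  nlinarith [sq_nonneg ((1 + x) ^ (s - 1) - (1 - x) ^ (s - 1))]

lemma aux1 (s : ℝ) (hs0 : 0 < s) (hs1 : s ≤ 1) (x : ℝ) (hx0 : 0 ≤ x) (hx1 : x ≤ 1) :
    2 * s * x ≤ (1 + x) ^ s - (1 - x) ^ s := by
  have hm : MonotoneOn (fun x : ℝ => (1 + x) ^ s - (1 - x) ^ s - 2 * s * x) (Set.Icc 0 1) := by
    have hd : ∀ z ∈ Set.Ioo (0:ℝ) 1, HasDerivAt (fun x : ℝ => (1 + x) ^ s - (1 - x) ^ s - 2 * s * x)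
        (1 * s * (1 + z) ^ (s - 1) - (-1) * s * (1 - z) ^ (s - 1) - 2 * s * 1) z := by
      intro z hz
      have a1 := ((hasDerivAt_id z).const_add 1).rpow_const (p := s) (Or.inl (by simp; linarith [hz.1]))
      have a2 := ((hasDerivAt_id z).const_sub 1).rpow_const (p := s) (Or.inl (by simp; linarith [hz.2]))
      exact (a1.sub a2).sub ((hasDerivAt_id z).const_mul (2 * s))
    refine monotoneOn_of_deriv_nonneg (convex_Icc 0 1) ?_ ?_ ?_
    · have : Continuous (fun x : ℝ => (1 + x) ^ s - (1 - x) ^ s - 2 * s * x) := by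
        have c1 : Continuous (fun x : ℝ => (1 + x) ^ s) := (by fun_prop : Continuous fun x : ℝ => 1 + x).rpow_const (fun _ => Or.inr hs0.le)
        have c2 : Continuous (fun x : ℝ => (1 - x) ^ s) := (by fun_prop : Continuous fun x : ℝ => 1 - x).rpow_const (fun _ => Or.inr hs0.le)
        fun_prop
      exact this.continuousOn
    · rw [interior_Icc]
      intro z hz
      exact (hd z hz).differentiableAt.differentiableWithinAt
    · rw [interior_Icc]
      intro z hz
      rw [(hd z hz).deriv]
      have := aux_deriv_s14 s hs0 hs1 z hz.1.le hz.2
      nlinarith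
  have := hm (Set.left_mem_Icc.2 zero_le_one) ⟨hx0, hx1⟩ hx0
  simp at this
  linarith

lemma aux2 (q : ℝ) (hq1 : 1 < q) (hq2 : q ≤ 2) (x : ℝ) (hx0 : 0 ≤ x) (hx1 : x ≤ 1) :
    2 + q * (q - 1) * x ^ 2 ≤ (1 + x) ^ q + (1 - x) ^ q := by
  have hm : MonotoneOn (fun x : ℝ => (1 + x) ^ q + (1 - x) ^ q - q * (q - 1) * x ^ 2) (Set.Icc 0 1) := by
    have hd : ∀ z ∈ Set.Ioo (0:ℝ) 1, HasDerivAt (fun x : ℝ => (1 + x) ^ q + (1 - x) ^ q - q * (q - 1) * x ^ 2)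
        (1 * q * (1 + z) ^ (q - 1) + (-1) * q * (1 - z) ^ (q - 1) - q * (q - 1) * (2 * z)) z := by
      intro z hz
      have a1 := ((hasDerivAt_id z).const_add 1).rpow_const (p := q) (Or.inl (by simp; linarith [hz.1]))
      have a2 := ((hasDerivAt_id z).const_sub 1).rpow_const (p := q) (Or.inl (by simp; linarith [hz.2]))
      have a3 := (hasDerivAt_pow 2 z).const_mul (q * (q - 1))
      simp only [Nat.cast_ofNat, Nat.add_one_sub_one, pow_one] at a3
      exact (a1.add a2).sub a3
    refine monotoneOn_of_deriv_nonneg (convex_Icc 0 1) ?_ ?_ ?_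
    · have hs0 : 0 ≤ q := by linarith
      have : Continuous (fun x : ℝ => (1 + x) ^ q + (1 - x) ^ q - q * (q - 1) * x ^ 2) := by
        have c1 : Continuous (fun x : ℝ => (1 + x) ^ q) := (by fun_prop : Continuous fun x : ℝ => 1 + x).rpow_const (fun _ => Or.inr hs0)
        have c2 : Continuous (fun x : ℝ => (1 - x) ^ q) := (by fun_prop : Continuous fun x : ℝ => 1 - x).rpow_const (fun _ => Or.inr hs0)
        fun_prop
      exact this.continuousOn
    · rw [interior_Icc]
      intro z hz
      exact (hd z hz).differentiableAt.differentiableWithinAt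
    · rw [interior_Icc]
      intro z hz
      rw [(hd z hz).deriv]
      have := aux1 (q - 1) (by linarith) (by linarith) z hz.1.le hz.2.le
      nlinarith
  have := hm (Set.left_mem_Icc.2 zero_le_one) ⟨hx0, hx1⟩ hx0
  simp at this
  linarith

lemma aux3 (q : ℝ) (hq1 : 1 < q) (hq2 : q ≤ 2) (x : ℝ) (hx0 : 0 ≤ x) (hx1 : x ≤ 1) :
    (1 + (q - 1) * x ^ 2) ^ (q / 2) ≤ ((1 + x) ^ q + (1 - x) ^ q) / 2 := by
  have h := aux2 q hq1 hq2 x hx0 hx1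
  have h0 : 0 ≤ (q - 1) * x ^ 2 := mul_nonneg (by linarith) (sq_nonneg x)
  have := rpow_one_add_le_one_add_mul_self (s := (q - 1) * x ^ 2) (p := q / 2) (by linarith) (by linarith) (by linarith)
  nlinarith

-- nonneg a,b with b ≤ a
lemma aux4 (q : ℝ) (hq1 : 1 < q) (hq2 : q ≤ 2) (a b : ℝ) (hb : 0 ≤ b) (hba : b ≤ a) :
    (a ^ 2 + (q - 1) * b ^ 2) ^ (q / 2) ≤ (|a + b| ^ q + |a - b| ^ q) / 2 := by
  rcases (hb.trans hba).eq_or_lt with h | ha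
  · subst h
    have : b = 0 := le_antisymm hba hb
    subst this
    simp
    rw [Real.zero_rpow (by linarith), Real.zero_rpow (by linarith)]
  have hx0 : 0 ≤ b / a := by positivity
  have hx1 : b / a ≤ 1 := (div_le_one ha).2 hba
  have h := aux3 q hq1 hq2 (b / a) hx0 hx1
  have e1 : a ^ 2 + (q - 1) * b ^ 2 = a ^ 2 * (1 + (q - 1) * (b / a) ^ 2) := by field_simp
  have e2 : |a + b| = a * (1 + b / a) := by
    rw [abs_of_nonneg (by linarith)]; field_simp
  have e3 : |a - b| = a * (1 - b / a) := by
    rw [abs_of_nonneg (by linarith)]; field_simp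
  have e4 : (a ^ 2) ^ (q / 2) = a ^ q := by
    rw [← Real.rpow_natCast, ← Real.rpow_mul ha.le]; congr 1; push_cast; ring
  have h5 : 0 ≤ (q - 1) * (b / a) ^ 2 := mul_nonneg (by linarith) (sq_nonneg _)
  rw [e1, e2, e3, Real.mul_rpow (by positivity) (by linarith), Real.mul_rpow ha.le (by linarith), Real.mul_rpow ha.le (by linarith), e4]
  have := mul_le_mul_of_nonneg_left h (Real.rpow_nonneg ha.le q)
  linarith

lemma aux5 (q : ℝ) (hq1 : 1 < q) (hq2 : q ≤ 2) (a b : ℝ) (ha : 0 ≤ a) (hb : 0 ≤ b) :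
    (a ^ 2 + (q - 1) * b ^ 2) ^ (q / 2) ≤ (|a + b| ^ q + |a - b| ^ q) / 2 := by
  rcases le_total b a with h | h
  · exact aux4 q hq1 hq2 a b hb h
  · have := aux4 q hq1 hq2 b a ha h
    rw [add_comm b a, abs_sub_comm b a] at this
    refine le_trans (Real.rpow_le_rpow ?_ ?_ (by linarith)) this
    · have : 0 ≤ (q - 1) * b ^ 2 := mul_nonneg (by linarith) (sq_nonneg _)
      positivity
    · have : a ^ 2 ≤ b ^ 2 := by gcongr
      nlinarith

lemma aux6 (q : ℝ) (hq1 : 1 < q) (hq2 : q ≤ 2) (a b : ℝ) :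
    (a ^ 2 + (q - 1) * b ^ 2) ^ (q / 2) ≤ (|a + b| ^ q + |a - b| ^ q) / 2 := by
  have h := aux5 q hq1 hq2 |a| |b| (abs_nonneg _) (abs_nonneg _)
  rw [sq_abs, sq_abs] at h
  refine h.trans (le_of_eq ?_)
  rcases abs_cases a with ⟨h1, _⟩ | ⟨h1, _⟩ <;> rcases abs_cases b with ⟨h2, _⟩ | ⟨h2, _⟩ <;> rw [h1, h2]
  · rw [← sub_eq_add_neg, sub_neg_eq_add, add_comm (|a - b| ^ q)]
  · rw [show -a + b = -(a - b) by ring, show -a - b = -(a + b) by ring, abs_neg, abs_neg, add_comm (|a - b| ^ q)]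
  · rw [show -a + -b = -(a + b) by ring, show -a - -b = -(a - b) by ring, abs_neg, abs_neg]

lemma mink {ι : Type*} (s : Finset ι) (r : ℝ) (hr : 1 ≤ r) (A B : ι → ℝ) (hA : ∀ i, 0 ≤ A i) (hB : ∀ i, 0 ≤ B i) :
    ((∑ i ∈ s, A i) ^ r + (∑ i ∈ s, B i) ^ r) ^ (1 / r) ≤ ∑ i ∈ s, (A i ^ r + B i ^ r) ^ (1 / r) := by
  classical
  induction s using Finset.induction_on with
  | empty => simp [Real.zero_rpow (by linarith : r ≠ 0), Real.zero_rpow (by positivity : r⁻¹ ≠ 0)]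
  | insert j s hj ih =>
    rw [Finset.sum_insert hj, Finset.sum_insert hj, Finset.sum_insert hj]
    have h := Real.Lp_add_le (Finset.univ : Finset (Fin 2)) ![A j, B j] ![∑ i ∈ s, A i, ∑ i ∈ s, B i] hr
    have h1 : 0 ≤ ∑ i ∈ s, A i := Finset.sum_nonneg fun i _ => hA i
    have h2 : 0 ≤ ∑ i ∈ s, B i := Finset.sum_nonneg fun i _ => hB i
    simp only [Fin.sum_univ_two, Matrix.cons_val_zero, Matrix.cons_val_one, abs_of_nonneg (hA j), abs_of_nonneg (hB j),
      abs_of_nonneg h1, abs_of_nonneg h2, abs_of_nonneg (add_nonneg (hA j) h1), abs_of_nonneg (add_nonneg (hB j) h2)] at h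
    linarith

lemma mid {n : ℕ} (q : ℝ) (hq1 : 1 < q) (hq2 : q ≤ 2) (a b : Fin n → ℝ) :
    (∑ i, |a i| ^ q) ^ (2 / q) + (q - 1) * (∑ i, |b i| ^ q) ^ (2 / q) ≤
      ((∑ i, |a i + b i| ^ q) ^ (2 / q) + (∑ i, |a i - b i| ^ q) ^ (2 / q)) / 2 := by
  have hq0 : 0 < q := by linarith
  have hr : 1 ≤ 2 / q := by rw [le_div_iff₀ hq0]; linarith
  have hqq : 0 ≤ q - 1 := by linarith
  have key : ∀ z : ℝ, (|z| ^ q) ^ (2 / q) = z ^ 2 := by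
    intro z
    rw [← Real.rpow_mul (abs_nonneg z), show q * (2 / q) = (2 : ℕ) by field_simp; norm_num, Real.rpow_natCast, sq_abs]
  have kc : ((q - 1) ^ (q / 2)) ^ (2 / q) = q - 1 := by
    rw [← Real.rpow_mul hqq, show q / 2 * (2 / q) = 1 by field_simp, Real.rpow_one]
  have hm := mink Finset.univ (2 / q) hr (fun i => |a i| ^ q) (fun i => (q - 1) ^ (q / 2) * |b i| ^ q)
    (fun i => by positivity) (fun i => by positivity)
  have hSb : 0 ≤ ∑ i, |b i| ^ q := Finset.sum_nonneg fun i _ => by positivity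
  have hSa : 0 ≤ ∑ i, |a i| ^ q := Finset.sum_nonneg fun i _ => by positivity
  have hS1 : 0 ≤ ∑ i, |a i + b i| ^ q := Finset.sum_nonneg fun i _ => by positivity
  have hS2 : 0 ≤ ∑ i, |a i - b i| ^ q := Finset.sum_nonneg fun i _ => by positivity
  rw [← Finset.mul_sum, Real.mul_rpow (by positivity) hSb, kc] at hm
  have h2 : ∑ i, ((|a i| ^ q) ^ (2 / q) + ((q - 1) ^ (q / 2) * |b i| ^ q) ^ (2 / q)) ^ (1 / (2 / q)) ≤
      (1 / 2) * (∑ i, |a i + b i| ^ q) + (1 / 2) * (∑ i, |a i - b i| ^ q) := by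
    rw [← mul_add, ← Finset.sum_add_distrib, Finset.mul_sum]
    refine Finset.sum_le_sum fun i _ => ?_
    rw [Real.mul_rpow (by positivity) (by positivity), kc, key, key, one_div_div]
    have := aux6 q hq1 hq2 (a i) (b i)
    linarith
  have h3 := Real.rpow_le_rpow (by positivity) (hm.trans h2) (by linarith : 0 ≤ 2 / q)
  rw [← Real.rpow_mul (by positivity), one_div_mul_cancel (by positivity), Real.rpow_one] at h3
  have h4 := (convexOn_rpow hr).2 (Set.mem_Ici.2 hS1) (Set.mem_Ici.2 hS2) (by norm_num : (0:ℝ) ≤ 1/2) (by norm_num : (0:ℝ) ≤ 1/2) (by norm_num)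
  simp only [smul_eq_mul] at h4
  linarith

lemma midconv (h : ℝ → ℝ) (hc : Continuous h) (h0 : h 0 ≤ 0) (h1 : h 1 ≤ 0)
    (hm : ∀ s δ, h s ≤ (h (s + δ) + h (s - δ)) / 2) (t : ℝ) (ht : t ∈ Set.Icc (0:ℝ) 1) : h t ≤ 0 := by
  by_contra hneg
  push Not at hneg
  obtain ⟨m, hmI, hmax⟩ := isCompact_Icc.exists_isMaxOn ⟨t, ht⟩ hc.continuousOn
  have hK : IsCompact (Set.Icc (0:ℝ) 1 ∩ {s | h m ≤ h s}) :=
    isCompact_Icc.inter_right (isClosed_le continuous_const hc)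
  obtain ⟨u, ⟨huI, hu⟩, hul⟩ := hK.exists_isLeast ⟨m, hmI, (le_refl (h m) : h m ≤ h m)⟩
  have hpos : 0 < h m := lt_of_lt_of_le hneg (hmax ht)
  simp only [Set.mem_setOf_eq] at hu
  have hu0 : 0 < u := lt_of_le_of_ne huI.1 (by rintro rfl; linarith)
  have hu1 : u < 1 := lt_of_le_of_ne huI.2 (by rintro rfl; linarith)
  have hd0 : 0 < min u (1 - u) := lt_min hu0 (by linarith)
  have hd1 := min_le_left u (1 - u)
  have hd2 := min_le_right u (1 - u)
  set δ := min u (1 - u)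
  have e1 : h (u + δ) ≤ h m := hmax ⟨by linarith, by linarith⟩
  have := hm u δ
  have := hul ⟨⟨by linarith, by linarith⟩, (by simp only [Set.mem_setOf_eq]; linarith : u - δ ∈ {s | h m ≤ h s})⟩
  linarith

lemma strong {n : ℕ} (q : ℝ) (hq1 : 1 < q) (hq2 : q ≤ 2) (x y : Fin n → ℝ) (t : ℝ) (ht : t ∈ Set.Icc (0:ℝ) 1) :
    (∑ i, |t * x i + (1 - t) * y i| ^ q) ^ (2 / q) ≤ t * (∑ i, |x i| ^ q) ^ (2 / q) +
      (1 - t) * (∑ i, |y i| ^ q) ^ (2 / q) - (q - 1) * t * (1 - t) * (∑ i, |x i - y i| ^ q) ^ (2 / q) := by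
  have hq0 : 0 < q := by linarith
  have hr : 0 < 2 / q := by positivity
  have hscale : ∀ δ : ℝ, (∑ i, |δ * (x i - y i)| ^ q) ^ (2 / q) = δ ^ 2 * (∑ i, |x i - y i| ^ q) ^ (2 / q) := by
    intro δ
    simp_rw [abs_mul, Real.mul_rpow (abs_nonneg _) (abs_nonneg _)]
    rw [← Finset.mul_sum, Real.mul_rpow (by positivity) (Finset.sum_nonneg fun i _ => by positivity),
      ← Real.rpow_mul (abs_nonneg δ), show q * (2 / q) = (2 : ℕ) by field_simp; norm_num, Real.rpow_natCast, sq_abs]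
  have := midconv (fun t => (∑ i, |t * x i + (1 - t) * y i| ^ q) ^ (2 / q) - (t * (∑ i, |x i| ^ q) ^ (2 / q) +
      (1 - t) * (∑ i, |y i| ^ q) ^ (2 / q) - (q - 1) * t * (1 - t) * (∑ i, |x i - y i| ^ q) ^ (2 / q))) ?_ ?_ ?_ ?_ t ht
  · linarith
  · have c1 : Continuous (fun t : ℝ => (∑ i, |t * x i + (1 - t) * y i| ^ q) ^ (2 / q)) := by
      refine Continuous.rpow_const ?_ (fun _ => Or.inr hr.le)
      refine continuous_finsetSum _ fun i _ => ?_
      refine Continuous.rpow_const (by fun_prop) (fun _ => Or.inr hq0.le)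
    fun_prop
  · simp
  · simp
  · intro s δ
    have h := mid q hq1 hq2 (fun i => s * x i + (1 - s) * y i) (fun i => δ * (x i - y i))
    rw [hscale] at h
    have e1 : ∀ i, s * x i + (1 - s) * y i + δ * (x i - y i) = (s + δ) * x i + (1 - (s + δ)) * y i := fun i => by ring
    have e2 : ∀ i, s * x i + (1 - s) * y i - δ * (x i - y i) = (s - δ) * x i + (1 - (s - δ)) * y i := fun i => by ring
    simp only [e1, e2] at h
    linarith

lemma cmp1 {n : ℕ} (q p : ℝ) (hq : 0 < q) (hqp : q ≤ p) (z : Fin n → ℝ) :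
    (∑ i, |z i| ^ p) ^ (1 / p) ≤ (∑ i, |z i| ^ q) ^ (1 / q) := by
  have hp : 0 < p := by linarith
  have hS : 0 ≤ ∑ i, |z i| ^ q := Finset.sum_nonneg fun i _ => by positivity
  set N := (∑ i, |z i| ^ q) ^ (1 / q) with hN
  have hN0 : 0 ≤ N := by positivity
  have hNq : N ^ q = ∑ i, |z i| ^ q := by
    rw [hN, ← Real.rpow_mul hS, one_div_mul_cancel hq.ne', Real.rpow_one]
  have hi : ∀ i, |z i| ≤ N := by
    intro i
    rw [← Real.rpow_le_rpow_iff (abs_nonneg _) hN0 hq, hNq]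
    exact Finset.single_le_sum (f := fun i => |z i| ^ q) (fun i _ => by positivity) (Finset.mem_univ i)
  have hle : ∑ i, |z i| ^ p ≤ N ^ p := by
    have e : N ^ p = N ^ (p - q) * N ^ q := by
      rw [← Real.rpow_add_of_nonneg hN0 (by linarith) hq.le]; congr 1; ring
    rw [e, hNq, Finset.mul_sum]
    refine Finset.sum_le_sum fun i _ => ?_
    have e : |z i| ^ p = |z i| ^ (p - q) * |z i| ^ q := by
      rw [← Real.rpow_add_of_nonneg (abs_nonneg _) (by linarith) hq.le]; congr 1; ring
    rw [e]
    exact mul_le_mul_of_nonneg_right (Real.rpow_le_rpow (abs_nonneg _) (hi i) (by linarith)) (by positivity)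
  have := Real.rpow_le_rpow (Finset.sum_nonneg fun i _ => by positivity) hle (by positivity : 0 ≤ 1 / p)
  rwa [← Real.rpow_mul hN0, mul_one_div_cancel hp.ne', Real.rpow_one] at this

lemma cmp2 {n : ℕ} (hn : 0 < n) (q p : ℝ) (hp : 0 < p) (hpq : p ≤ q) (z : Fin n → ℝ) :
    (n : ℝ) ^ (1 / q - 1 / p) * (∑ i, |z i| ^ p) ^ (1 / p) ≤ (∑ i, |z i| ^ q) ^ (1 / q) := by
  have hq : 0 < q := by linarith
  have hn' : (0:ℝ) < n := by exact_mod_cast hn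
  have h := Real.rpow_sum_le_const_mul_sum_rpow (Finset.univ : Finset (Fin n)) (fun i => |z i| ^ p)
    (p := q / p) ((one_le_div hp).2 hpq)
  have hS : 0 ≤ ∑ i, |z i| ^ p := Finset.sum_nonneg fun i _ => by positivity
  have hS' : 0 ≤ ∑ i, |z i| ^ q := Finset.sum_nonneg fun i _ => by positivity
  have e : ∀ i, |(|z i| ^ p)| = |z i| ^ p := fun i => abs_of_nonneg (by positivity)
  have e2 : ∀ i, (|z i| ^ p) ^ (q / p) = |z i| ^ q := fun i => by
    rw [← Real.rpow_mul (abs_nonneg _)]; congr 1; field_simp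
  simp only [e, e2, Finset.card_univ, Fintype.card_fin] at h
  have h3 := Real.rpow_le_rpow (by positivity) h (by positivity : 0 ≤ 1 / q)
  rw [← Real.rpow_mul hS, Real.mul_rpow (by positivity) hS', ← Real.rpow_mul hn'.le,
    show q / p * (1 / q) = 1 / p by field_simp, show (q / p - 1) * (1 / q) = 1 / p - 1 / q by field_simp] at h3
  calc _ ≤ (n : ℝ) ^ (1 / q - 1 / p) * ((n : ℝ) ^ (1 / p - 1 / q) * (∑ i, |z i| ^ q) ^ (1 / q)) := by gcongr
    _ = _ := by
      rw [← mul_assoc, ← Real.rpow_add hn']; simp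

lemma pnorm_coe {n : ℕ} (p : ℝ≥0∞) (hp : p ≠ ⊤) (x : Fin n → ℝ) :
    pnorm p x = (∑ i, |x i| ^ p.toReal) ^ (1 / p.toReal) := by
  simp [pnorm, hp]

lemma pnorm_nonneg' {n : ℕ} (p : ℝ≥0∞) (x : Fin n → ℝ) : 0 ≤ pnorm p x := by
  unfold pnorm
  split_ifs
  · exact Real.iSup_nonneg fun i => abs_nonneg _
  · exact Real.rpow_nonneg (Finset.sum_nonneg fun i _ => by positivity) _

lemma pnorm_anti {n : ℕ} (q : ℝ) (hq : 0 < q) (p : ℝ≥0∞) (hp : ENNReal.ofReal q ≤ p) (x : Fin n → ℝ) :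
    pnorm p x ≤ (∑ i, |x i| ^ q) ^ (1 / q) := by
  by_cases h : p = ⊤
  · simp only [pnorm, h, if_true]
    have hS : 0 ≤ ∑ i, |x i| ^ q := Finset.sum_nonneg fun i _ => by positivity
    refine Real.iSup_le (fun i => ?_) (by positivity)
    rw [← Real.rpow_le_rpow_iff (abs_nonneg _) (by positivity) hq, ← Real.rpow_mul hS,
      one_div_mul_cancel hq.ne', Real.rpow_one]
    exact Finset.single_le_sum (f := fun i => |x i| ^ q) (fun i _ => by positivity) (Finset.mem_univ i)
  · rw [pnorm_coe p h]
    exact cmp1 q p.toReal hq ((ENNReal.ofReal_le_iff_le_toReal h).1 hp) x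

lemma sq_rpow (S q : ℝ) (hS : 0 ≤ S) : (S ^ (1 / q)) ^ 2 = S ^ (2 / q) := by
  rw [← Real.rpow_natCast, ← Real.rpow_mul hS]; congr 1; push_cast; ring


/-- for `p' ∈ (1, 2]`, the prox-function `d_{p'}(x) = ½‖x‖_{ℓ^{p'}}²` is
(i) `(p'−1)`-strongly convex w.r.t. `‖·‖_{ℓ^p}` for every `p ∈ [p', ∞]`, and
(ii) `(p'−1) n^{2(1/p'−1/p)}`-strongly convex w.r.t. `‖·‖_{ℓ^p}` for every `p ∈ [1, p']`. -/
theorem stmt14 (n : ℕ) (hn : 0 < n) (p' : ℝ) (hp'1 : 1 < p') (hp'2 : p' ≤ 2) :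
    let d : (Fin n → ℝ) → ℝ := fun x => 1 / 2 * pnorm (ENNReal.ofReal p') x ^ 2
    (∀ p : ℝ≥0∞, ENNReal.ofReal p' ≤ p →
      ∀ x y : Fin n → ℝ, ∀ t ∈ Set.Icc (0 : ℝ) 1,
        d (t • x + (1 - t) • y) ≤ t * d x + (1 - t) * d y -
          (p' - 1) / 2 * t * (1 - t) * pnorm p (x - y) ^ 2) ∧
    (∀ p : ℝ≥0∞, 1 ≤ p → p ≤ ENNReal.ofReal p' →
      ∀ x y : Fin n → ℝ, ∀ t ∈ Set.Icc (0 : ℝ) 1,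
        d (t • x + (1 - t) • y) ≤ t * d x + (1 - t) * d y -
          (p' - 1) * (n : ℝ) ^ (2 * (1 / p' - 1 / p.toReal)) / 2 * t * (1 - t) *
            pnorm p (x - y) ^ 2) := by
  intro d
  have hq0 : 0 < p' := by linarith
  have hd : ∀ x, d x = 1 / 2 * (∑ i, |x i| ^ p') ^ (2 / p') := by
    intro x
    simp only [d]
    rw [pnorm_coe _ ENNReal.ofReal_ne_top, ENNReal.toReal_ofReal hq0.le,
      sq_rpow _ _ (Finset.sum_nonneg fun i _ => by positivity)]
  have hs : ∀ x y : Fin n → ℝ, ∀ t ∈ Set.Icc (0 : ℝ) 1,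
      d (t • x + (1 - t) • y) ≤ t * d x + (1 - t) * d y -
        (p' - 1) / 2 * t * (1 - t) * ((∑ i, |(x - y) i| ^ p') ^ (1 / p')) ^ 2 := by
    intro x y t ht
    have := strong p' hp'1 hp'2 x y t ht
    rw [hd, hd, hd, sq_rpow _ _ (Finset.sum_nonneg fun i _ => by positivity)]
    simp only [Pi.add_apply, Pi.smul_apply, smul_eq_mul, Pi.sub_apply]
    linarith
  constructor
  · intro p hp x y t ht
    have h1 := hs x y t ht
    have h2 := pow_le_pow_left₀ (pnorm_nonneg' p (x - y)) (pnorm_anti p' hq0 p hp (x - y)) 2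
    have h3 : 0 ≤ (p' - 1) / 2 * t * (1 - t) :=
      mul_nonneg (mul_nonneg (by linarith) ht.1) (by linarith [ht.2])
    have := mul_le_mul_of_nonneg_left h2 h3
    linarith
  · intro p hp1 hp x y t ht
    have h1 := hs x y t ht
    have hpt : p ≠ ⊤ := ne_top_of_le_ne_top ENNReal.ofReal_ne_top hp
    have hp0 : 0 < p.toReal := ENNReal.toReal_pos (by rintro rfl; simp at hp1) hpt
    have hpp : p.toReal ≤ p' := ENNReal.toReal_le_of_le_ofReal hq0.le hp
    have h0 := cmp2 hn p' p.toReal hp0 hpp (x - y)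
    rw [← pnorm_coe p hpt] at h0
    have h2 := pow_le_pow_left₀ (mul_nonneg (by positivity) (pnorm_nonneg' p (x - y))) h0 2
    have h3 : 0 ≤ (p' - 1) / 2 * t * (1 - t) :=
      mul_nonneg (mul_nonneg (by linarith) ht.1) (by linarith [ht.2])
    have e : (n : ℝ) ^ (2 * (1 / p' - 1 / p.toReal)) = ((n : ℝ) ^ (1 / p' - 1 / p.toReal)) ^ 2 := by
      rw [← Real.rpow_natCast, ← Real.rpow_mul (by positivity)]; congr 1; push_cast; ring
    rw [mul_pow, ← e] at h2
    have := mul_le_mul_of_nonneg_left h2 h3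
    linarith
end
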